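/- arXiv:2501.01627 — 6 statements merged into one kernel-verified Lean document; each statement's English description precedes it below -/
import Mathlib

section
/- Let f = h + conj(g) be a harmonic K-quasiregular mapping in the unit disk 𝔻 (so h, g are analytic in 𝔻, g(0)=0, h'(z) ≠ 0 and |g'(z)| ≤ k·|h'(z)| for all z ∈ 𝔻, where k = (K−1)/(K+1)), write u = Re f and v = Im f, and assume u(z) ≥ 1 for all z ∈ 𝔻 and v(0) = 0. If u belongs to the class h·log⁺h (i.e., the integrals ∫₀^{2π} |u(re^{iθ})| log⁺|u(re^{iθ})| dθ are bounded uniformly in r < 1), then f ∈ h¹, and for every 0 < r < 1, M₁(r,f) ≤ (K²/2π) ∫₀^{2π} |u(re^{iθ})| log⁺|u(re^{iθ})| dθ + |u(0)|·(1 − K² log|u(0)|). -/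
open Complex Real Set

noncomputable section

/-- The open unit disk in the complex plane. -/
def unitDisk : Set ℂ := Metric.ball 0 1

/-- The integral mean `M_p(r, f)` of a complex-valued function `f`. -/
def circleMean (p : ℝ) (f : ℂ → ℂ) (r : ℝ) : ℝ :=
  ((1 / (2 * π)) *
    ∫ θ in (0:ℝ)..(2 * π), ‖f (r * Complex.exp (θ * Complex.I))‖ ^ p) ^ (1 / p)

/-- Membership in the (harmonic/analytic) Hardy space of exponent `p`. -/
def InHardy (p : ℝ) (f : ℂ → ℂ) : Prop :=
  ∃ C : ℝ, ∀ r : ℝ, 0 < r → r < 1 → circleMean p f r ≤ C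

/-- `log⁺ x = max (log x) 0`. -/
def logPlus (x : ℝ) : ℝ := max (Real.log x) 0

/-- The integral `∫₀^{2π} |u(re^{iθ})| log⁺|u(re^{iθ})| dθ`. -/
def zygmundIntegral (u : ℂ → ℝ) (r : ℝ) : ℝ :=
  ∫ θ in (0:ℝ)..(2 * π),
    |u (r * Complex.exp (θ * Complex.I))| * logPlus |u (r * Complex.exp (θ * Complex.I))|

/-- The class `h·log⁺h`: real-valued harmonic functions with uniformly bounded
`∫ |u| log⁺|u|` integrals. -/
def InZygmundClass (u : ℂ → ℝ) : Prop :=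
  ∃ C : ℝ, ∀ r : ℝ, 0 < r → r < 1 → zygmundIntegral u r ≤ C

/-- Differentiation under the integral sign for a jointly continuous derivative. -/
theorem hasDerivAt_intervalIntegral_of_continuousOn {F F' : ℝ → ℝ → ℝ} {a b c d r : ℝ}
    (hr : r ∈ Ioo c d) (hF : ∀ x ∈ Ioo c d, Continuous (F x))
    (hF' : ContinuousOn (Function.uncurry F') (Ioo c d ×ˢ univ))
    (hd : ∀ x ∈ Ioo c d, ∀ θ, HasDerivAt (fun y => F y θ) (F' x θ) x) :
    HasDerivAt (fun x => ∫ θ in a..b, F x θ) (∫ θ in a..b, F' r θ) r := by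
  obtain ⟨c', hc, hc'⟩ := exists_between hr.1
  obtain ⟨d', hd₁, hd'⟩ := exists_between hr.2
  have hsub : Icc c' d' ⊆ Ioo c d := fun x hx => ⟨hc.trans_le hx.1, hx.2.trans_lt hd'⟩
  obtain ⟨C, hC⟩ := (isCompact_Icc.prod
    (isCompact_uIcc (a := a) (b := b))).exists_bound_of_continuousOn (hF'.mono (prod_mono hsub (subset_univ _)))
  have hF'r : Continuous (F' r) :=
    hF'.comp_continuous (Continuous.prodMk_right r) fun θ => ⟨hr, mem_univ _⟩
  refine (intervalIntegral.hasDerivAt_integral_of_dominated_loc_of_deriv_le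
    (bound := fun _ => C) (Icc_mem_nhds hc' hd₁) ?_ ((hF r hr).intervalIntegrable _ _)
    hF'r.aestronglyMeasurable ?_ intervalIntegrable_const ?_).2
  · filter_upwards [Icc_mem_nhds hc' hd₁] with x hx
    exact (hF x (hsub hx)).aestronglyMeasurable
  · exact .of_forall fun θ hθ x hx => hC (x, θ) ⟨hx, uIoc_subset_uIcc hθ⟩
  · exact .of_forall fun θ _ x hx => hd x (hsub hx) θ

/-- The function `K² x log x - |z|` with `x = Re z`. -/
def zygmundPot (K : ℝ) (z : ℂ) : ℝ := K ^ 2 * (z.re * Real.log z.re) - ‖z‖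

/-- The differential of `zygmundPot K` at `z` in the direction `q`. -/
def zygmundPotDeriv (K : ℝ) (z q : ℂ) : ℝ :=
  K ^ 2 * (q.re * (Real.log z.re + 1)) - (z.re * q.re + z.im * q.im) / ‖z‖

/-- The Hessian of `zygmundPot K` at `z`, as a quadratic form in `q`. -/
def zygmundPotHess (K : ℝ) (z q : ℂ) : ℝ :=
  K ^ 2 * (q.re ^ 2 / z.re)
    - ((q.re ^ 2 + q.im ^ 2) / ‖z‖ - (z.re * q.re + z.im * q.im) ^ 2 / ‖z‖ ^ 3)

theorem HasDerivAt.complex_re {p : ℝ → ℂ} {q : ℂ} {t : ℝ} (hp : HasDerivAt p q t) :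
    HasDerivAt (fun s => (p s).re) q.re t :=
  (Complex.reCLM.hasFDerivAt (x := p t)).comp_hasDerivAt t hp

theorem HasDerivAt.complex_im {p : ℝ → ℂ} {q : ℂ} {t : ℝ} (hp : HasDerivAt p q t) :
    HasDerivAt (fun s => (p s).im) q.im t :=
  (Complex.imCLM.hasFDerivAt (x := p t)).comp_hasDerivAt t hp

theorem norm_pos_of_re_pos {z : ℂ} (hz : 0 < z.re) : 0 < ‖z‖ :=
  hz.trans_le (Complex.re_le_norm z)

theorem HasDerivAt.complex_norm {p : ℝ → ℂ} {q : ℂ} {t : ℝ} (hp : HasDerivAt p q t)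
    (h0 : 0 < (p t).re) :
    HasDerivAt (fun s => ‖p s‖) (((p t).re * q.re + (p t).im * q.im) / ‖p t‖) t := by
  have hn := norm_pos_of_re_pos h0
  have h1 : HasDerivAt (fun s => (p s).re ^ 2 + (p s).im ^ 2)
      (2 * ((p t).re * q.re + (p t).im * q.im)) t := by
    refine ((hp.complex_re.pow 2).add (hp.complex_im.pow 2)).congr_deriv ?_
    push_cast
    ring
  have h2 := h1.sqrt (by positivity)
  simp only [← Complex.norm_eq_sqrt_sq_add_sq] at h2
  exact h2.congr_deriv (mul_div_mul_left _ _ two_ne_zero)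

theorem hasDerivAt_zygmundPot (K : ℝ) {p : ℝ → ℂ} {q : ℂ} {t : ℝ} (hp : HasDerivAt p q t)
    (h0 : 0 < (p t).re) :
    HasDerivAt (fun s => zygmundPot K (p s)) (zygmundPotDeriv K (p t) q) t := by
  unfold zygmundPot zygmundPotDeriv
  refine (((hp.complex_re.mul (hp.complex_re.log h0.ne')).const_mul (K ^ 2)).sub
    (hp.complex_norm h0)).congr_deriv ?_
  field_simp

theorem hasDerivAt_zygmundPotDeriv (K : ℝ) {p q : ℝ → ℂ} {s : ℂ} {t : ℝ}
    (hp : HasDerivAt p (q t) t) (hq : HasDerivAt q s t) (h0 : 0 < (p t).re) :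
    HasDerivAt (fun x => zygmundPotDeriv K (p x) (q x))
      (zygmundPotHess K (p t) (q t) + zygmundPotDeriv K (p t) s) t := by
  have hn := norm_pos_of_re_pos h0
  unfold zygmundPotDeriv zygmundPotHess
  refine (((hq.complex_re.mul ((hp.complex_re.log h0.ne').add_const 1)).const_mul (K ^ 2)).sub
    (((hp.complex_re.mul hq.complex_re).add (hp.complex_im.mul hq.complex_im)).div
      (hp.complex_norm h0) hn.ne')).congr_deriv ?_
  simp only [Pi.add_apply, Pi.mul_apply]
  field_simp
  ring

theorem ContinuousOn.zygmundPot {X : Type*} [TopologicalSpace X] {S : Set X} (K : ℝ) {p : X → ℂ}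
    (hp : ContinuousOn p S) (h0 : ∀ x ∈ S, 0 < (p x).re) :
    ContinuousOn (fun x => zygmundPot K (p x)) S := by
  unfold _root_.zygmundPot
  have h1 : ∀ x ∈ S, (p x).re ≠ 0 := fun x hx => (h0 x hx).ne'
  fun_prop (disch := assumption)

theorem ContinuousOn.zygmundPotDeriv {X : Type*} [TopologicalSpace X] {S : Set X} (K : ℝ)
    {p q : X → ℂ} (hp : ContinuousOn p S) (hq : ContinuousOn q S) (h0 : ∀ x ∈ S, 0 < (p x).re) :
    ContinuousOn (fun x => zygmundPotDeriv K (p x) (q x)) S := by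
  unfold _root_.zygmundPotDeriv
  have h1 : ∀ x ∈ S, (p x).re ≠ 0 := fun x hx => (h0 x hx).ne'
  have h2 : ∀ x ∈ S, ‖p x‖ ≠ 0 := fun x hx => (norm_pos_of_re_pos (h0 x hx)).ne'
  fun_prop (disch := assumption)

theorem ContinuousOn.zygmundPotHess {X : Type*} [TopologicalSpace X] {S : Set X} (K : ℝ)
    {p q : X → ℂ} (hp : ContinuousOn p S) (hq : ContinuousOn q S) (h0 : ∀ x ∈ S, 0 < (p x).re) :
    ContinuousOn (fun x => zygmundPotHess K (p x) (q x)) S := by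
  unfold _root_.zygmundPotHess
  have h1 : ∀ x ∈ S, (p x).re ≠ 0 := fun x hx => (h0 x hx).ne'
  have h2 : ∀ x ∈ S, ‖p x‖ ≠ 0 := fun x hx => (norm_pos_of_re_pos (h0 x hx)).ne'
  have h3 : ∀ x ∈ S, ‖p x‖ ^ 3 ≠ 0 := fun x hx => pow_ne_zero _ (h2 x hx)
  fun_prop (disch := assumption)

/-- Subharmonicity of `K² u log u - |f|`: `α` and `β` stand for the (rotated) derivatives of the
analytic and co-analytic parts of `f`. -/
theorem zygmundPotHess_add_nonneg {K : ℝ} (hK : 1 ≤ K) {p α β : ℂ} (h0 : 0 < p.re)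
    (hαβ : ‖β‖ ≤ (K - 1) / (K + 1) * ‖α‖) :
    0 ≤ zygmundPotHess K p (α + (starRingEnd ℂ) β)
      + zygmundPotHess K p (α * I + (starRingEnd ℂ) (β * I)) := by
  have hn := norm_pos_of_re_pos h0
  have hxn : p.re ≤ ‖p‖ := Complex.re_le_norm p
  have hdil : ‖α‖ + ‖β‖ ≤ K * (‖α‖ - ‖β‖) := by
    rw [div_mul_eq_mul_div, le_div_iff₀ (by linarith)] at hαβ
    linarith
  have hsq : (‖α‖ + ‖β‖) ^ 2 ≤ K ^ 2 * ‖α + β‖ ^ 2 := by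
    rw [← mul_pow]
    have : ‖α‖ - ‖β‖ ≤ ‖α + β‖ := by
      simpa using norm_sub_norm_le α (-β)
    gcongr
    exact hdil.trans (by gcongr)
  have hcross : (‖p‖ * (‖α‖ - ‖β‖)) ^ 2 ≤ ‖(starRingEnd ℂ) p * α + p * β‖ ^ 2 := by
    have h1 : |‖(starRingEnd ℂ) p * α‖ - ‖-(p * β)‖| ≤ ‖(starRingEnd ℂ) p * α - -(p * β)‖ :=
      abs_norm_sub_norm_le _ _
    rw [sub_neg_eq_add, norm_neg, norm_mul, norm_mul, RCLike.norm_conj, ← mul_sub] at h1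
    rw [← sq_abs (‖p‖ * _)]
    gcongr
  have heq : zygmundPotHess K p (α + (starRingEnd ℂ) β)
      + zygmundPotHess K p (α * I + (starRingEnd ℂ) (β * I))
      = K ^ 2 * ‖α + β‖ ^ 2 / p.re - 2 * (‖α‖ ^ 2 + ‖β‖ ^ 2) / ‖p‖
        + ‖(starRingEnd ℂ) p * α + p * β‖ ^ 2 / ‖p‖ ^ 3 := by
    unfold zygmundPotHess
    simp only [Complex.sq_norm (α + β), Complex.sq_norm α, Complex.sq_norm β,
      Complex.sq_norm (_ + _ * β), Complex.normSq_apply]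
    simp
    field_simp
    ring
  rw [heq]
  have h1 : (‖α‖ + ‖β‖) ^ 2 / ‖p‖ ≤ K ^ 2 * ‖α + β‖ ^ 2 / p.re := by gcongr
  have h2 : (‖α‖ - ‖β‖) ^ 2 / ‖p‖ ≤ ‖(starRingEnd ℂ) p * α + p * β‖ ^ 2 / ‖p‖ ^ 3 := by
    calc (‖α‖ - ‖β‖) ^ 2 / ‖p‖ = (‖p‖ * (‖α‖ - ‖β‖)) ^ 2 / ‖p‖ ^ 3 := by field_simp
      _ ≤ _ := by gcongr
  have h3 : (‖α‖ + ‖β‖) ^ 2 / ‖p‖ + (‖α‖ - ‖β‖) ^ 2 / ‖p‖ = 2 * (‖α‖ ^ 2 + ‖β‖ ^ 2) / ‖p‖ := by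
    field_simp
    ring
  linarith

theorem HasDerivAt.harmonic_comp {φ ψ : ℂ → ℂ} {a b c : ℂ} {w : ℝ → ℂ} {t : ℝ}
    (hφ : HasDerivAt φ a (w t)) (hψ : HasDerivAt ψ b (w t)) (hw : HasDerivAt w c t) :
    HasDerivAt (fun s => φ (w s) + (starRingEnd ℂ) (ψ (w s)))
      (a * c + (starRingEnd ℂ) (b * c)) t :=
  (hφ.comp t hw).add (Complex.conjCLE.toContinuousLinearMap.hasFDerivAt.comp_hasDerivAt t
    (hψ.comp t hw))

/-- The second-order version of `HasDerivAt.harmonic_comp`. -/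
theorem HasDerivAt.harmonic_comp_mul {φ ψ : ℂ → ℂ} {a b d : ℂ} {w c : ℝ → ℂ} {t : ℝ}
    (hφ : HasDerivAt φ a (w t)) (hψ : HasDerivAt ψ b (w t)) (hw : HasDerivAt w (c t) t)
    (hc : HasDerivAt c d t) :
    HasDerivAt (fun s => φ (w s) * c s + (starRingEnd ℂ) (ψ (w s) * c s))
      (a * c t * c t + φ (w t) * d + (starRingEnd ℂ) (b * c t * c t + ψ (w t) * d)) t :=
  ((hφ.comp t hw).mul hc).add (Complex.conjCLE.toContinuousLinearMap.hasFDerivAt.comp_hasDerivAt t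
    ((hψ.comp t hw).mul hc))

/-- A function `m` on `[0, 1)` increases as soon as `r m'(r)` does. -/
theorem monotoneOn_of_deriv_mul_nonneg {m m' m'' : ℝ → ℝ}
    (h1 : ∀ r ∈ Ioo (-1 : ℝ) 1, HasDerivAt m (m' r) r)
    (h2 : ∀ r ∈ Ioo (-1 : ℝ) 1, HasDerivAt m' (m'' r) r)
    (h3 : ∀ r ∈ Ioo (0 : ℝ) 1, 0 ≤ m' r + r * m'' r) : MonotoneOn m (Ico 0 1) := by
  have hsub : ∀ r ∈ Ico (0 : ℝ) 1, r ∈ Ioo (-1 : ℝ) 1 := fun r hr => ⟨by linarith [hr.1], hr.2⟩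
  have hA : ∀ r ∈ Ioo (-1 : ℝ) 1, HasDerivAt (fun r => r * m' r) (m' r + r * m'' r) r := by
    intro r hr
    exact ((hasDerivAt_id r).mul (h2 r hr)).congr_deriv (by simp)
  have hmono : MonotoneOn (fun r => r * m' r) (Ico 0 1) := by
    refine monotoneOn_of_deriv_nonneg (convex_Ico 0 1)
      (fun r hr => (hA r (hsub r hr)).continuousAt.continuousWithinAt) ?_ ?_ <;>
      rw [interior_Ico] <;> intro r hr
    · exact (hA r (hsub r ⟨hr.1.le, hr.2⟩)).differentiableAt.differentiableWithinAt
    · rw [(hA r (hsub r ⟨hr.1.le, hr.2⟩)).deriv]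
      exact h3 r hr
  refine monotoneOn_of_deriv_nonneg (convex_Ico 0 1)
    (fun r hr => (h1 r (hsub r hr)).continuousAt.continuousWithinAt) ?_ ?_ <;>
    rw [interior_Ico] <;> intro r hr
  · exact (h1 r (hsub r ⟨hr.1.le, hr.2⟩)).differentiableAt.differentiableWithinAt
  · rw [(h1 r (hsub r ⟨hr.1.le, hr.2⟩)).deriv]
    have := hmono ⟨le_rfl, one_pos⟩ ⟨hr.1.le, hr.2⟩ hr.1.le
    simp only [zero_mul] at this
    exact nonneg_of_mul_nonneg_right this hr.1

theorem ofReal_mul_exp_mem_unitDisk {r : ℝ} (hr : r ∈ Ioo (-1 : ℝ) 1) (θ : ℝ) :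
    (r : ℂ) * Complex.exp (θ * I) ∈ unitDisk := by
  simpa [unitDisk, Complex.norm_exp_ofReal_mul_I, abs_lt] using hr

/-- The mean value inequality for `K² u log u - |f|`, with `f = h + conj g` and `u = Re f`. -/
theorem zygmundPot_le_integral {K : ℝ} (hK : 1 ≤ K) {h g : ℂ → ℂ}
    (hh : DifferentiableOn ℂ h unitDisk) (hg : DifferentiableOn ℂ g unitDisk)
    (hqr : ∀ z ∈ unitDisk, ‖deriv g z‖ ≤ (K - 1) / (K + 1) * ‖deriv h z‖)
    (hpos : ∀ z ∈ unitDisk, 0 < (h z + (starRingEnd ℂ) (g z)).re) {r : ℝ} (hr0 : 0 < r)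
    (hr1 : r < 1) :
    2 * π * zygmundPot K (h 0 + (starRingEnd ℂ) (g 0)) ≤
      ∫ θ in (0 : ℝ)..(2 * π), zygmundPot K (h (r * Complex.exp (θ * I))
        + (starRingEnd ℂ) (g (r * Complex.exp (θ * I)))) := by
  have hopen : IsOpen unitDisk := Metric.isOpen_ball
  have hh' : DifferentiableOn ℂ (deriv h) unitDisk := hh.deriv hopen
  have hg' : DifferentiableOn ℂ (deriv g) unitDisk := hg.deriv hopen
  have hch2 : ContinuousOn (deriv (deriv h)) unitDisk := (hh'.deriv hopen).continuousOn
  have hcg2 : ContinuousOn (deriv (deriv g)) unitDisk := (hg'.deriv hopen).continuousOn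
  have toD : ∀ {φ : ℂ → ℂ}, DifferentiableOn ℂ φ unitDisk → ∀ z ∈ unitDisk,
      HasDerivAt φ (deriv φ z) z :=
    fun hφ z hz => (hφ.differentiableAt (hopen.mem_nhds hz)).hasDerivAt
  set W : ℝ → ℝ → ℂ := fun r θ => r * Complex.exp (θ * I) with hW
  set e : ℝ → ℂ := fun θ => Complex.exp (θ * I) with he
  have hWmem : ∀ r ∈ Ioo (-1 : ℝ) 1, ∀ θ, W r θ ∈ unitDisk :=
    fun r hr θ => ofReal_mul_exp_mem_unitDisk hr θ
  have hWr : ∀ r θ, HasDerivAt (fun r => W r θ) (e θ) r := by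
    intro r θ
    simpa using (Complex.ofRealCLM.hasDerivAt (x := r)).mul_const (e θ)
  have hWθ : ∀ r θ, HasDerivAt (fun θ => W r θ) (W r θ * I) θ := by
    intro r θ
    have h1 : HasDerivAt (fun θ : ℝ => (θ : ℂ) * I) I θ := by
      simpa using (Complex.ofRealCLM.hasDerivAt (x := θ)).mul_const I
    simpa [hW, mul_assoc] using h1.cexp.const_mul (r : ℂ)
  have hWc : Continuous (Function.uncurry W) := by
    simp only [hW, Function.uncurry_def]; fun_prop
  have hec : Continuous e := by fun_prop
  set P : ℝ → ℝ → ℂ := fun r θ => h (W r θ) + (starRingEnd ℂ) (g (W r θ)) with hP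
  -- derivative of `P` along a direction `c`
  set P1 : ℝ → ℝ → ℂ → ℂ := fun r θ c =>
    deriv h (W r θ) * c + (starRingEnd ℂ) (deriv g (W r θ) * c) with hP1
  set P2 : ℝ → ℝ → ℂ → ℂ → ℂ := fun r θ c d =>
    deriv (deriv h) (W r θ) * c * c + deriv h (W r θ) * d
      + (starRingEnd ℂ) (deriv (deriv g) (W r θ) * c * c + deriv g (W r θ) * d) with hP2
  have hPpos : ∀ r ∈ Ioo (-1 : ℝ) 1, ∀ θ, 0 < (P r θ).re := fun r hr θ => hpos _ (hWmem r hr θ)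
  set S : Set (ℝ × ℝ) := Ioo (-1 : ℝ) 1 ×ˢ univ with hS
  have hcomp : ∀ {φ : ℂ → ℂ}, ContinuousOn φ unitDisk →
      ContinuousOn (fun x : ℝ × ℝ => φ (W x.1 x.2)) S := fun hφ =>
    hφ.comp hWc.continuousOn fun x hx => hWmem x.1 hx.1 x.2
  have hc0 := hcomp hh.continuousOn
  have hc1 := hcomp hh'.continuousOn
  have hc2 := hcomp hch2
  have hd0 := hcomp hg.continuousOn
  have hd1 := hcomp hg'.continuousOn
  have hd2 := hcomp hcg2
  have hconj : Continuous (starRingEnd ℂ) := Complex.continuous_conj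
  have hPc : ContinuousOn (fun x : ℝ × ℝ => P x.1 x.2) S :=
    hc0.add (hconj.comp_continuousOn hd0)
  have hP1c : ∀ {c : ℝ × ℝ → ℂ}, Continuous c → ContinuousOn (fun x => P1 x.1 x.2 (c x)) S :=
    fun hc => (hc1.mul hc.continuousOn).add
      (hconj.comp_continuousOn (hd1.mul hc.continuousOn))
  have hP2c : ∀ {c d : ℝ × ℝ → ℂ}, Continuous c → Continuous d →
      ContinuousOn (fun x => P2 x.1 x.2 (c x) (d x)) S := fun hc hd =>
    (((hc2.mul hc.continuousOn).mul hc.continuousOn).add (hc1.mul hd.continuousOn)).add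
      (hconj.comp_continuousOn
        (((hd2.mul hc.continuousOn).mul hc.continuousOn).add (hd1.mul hd.continuousOn)))
  have hSpos : ∀ x ∈ S, 0 < (P x.1 x.2).re := fun x hx => hPpos x.1 hx.1 x.2
  have hslice : ∀ {F : ℝ → ℝ → ℝ}, ContinuousOn (Function.uncurry F) S →
      ∀ r ∈ Ioo (-1 : ℝ) 1, Continuous (F r) := fun hF r hr =>
    hF.comp_continuous (Continuous.prodMk_right r) fun θ => ⟨hr, mem_univ _⟩
  set F0 : ℝ → ℝ → ℝ := fun r θ => zygmundPot K (P r θ) with hF0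
  set F1 : ℝ → ℝ → ℝ := fun r θ => zygmundPotDeriv K (P r θ) (P1 r θ (e θ)) with hF1
  set F2 : ℝ → ℝ → ℝ := fun r θ => zygmundPotHess K (P r θ) (P1 r θ (e θ))
    + zygmundPotDeriv K (P r θ) (P2 r θ (e θ) 0) with hF2
  set G : ℝ → ℝ → ℝ := fun r θ => zygmundPotHess K (P r θ) (P1 r θ (W r θ * I))
    + zygmundPotDeriv K (P r θ) (P2 r θ (W r θ * I) (W r θ * I * I)) with hG
  have hec' : Continuous fun x : ℝ × ℝ => e x.2 := hec.comp continuous_snd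
  have hWI : Continuous fun x : ℝ × ℝ => W x.1 x.2 * I := hWc.mul continuous_const
  have hF0c : ContinuousOn (Function.uncurry F0) S := hPc.zygmundPot K hSpos
  have hF1c : ContinuousOn (Function.uncurry F1) S :=
    hPc.zygmundPotDeriv K (hP1c hec') hSpos
  have hF2c : ContinuousOn (Function.uncurry F2) S :=
    (hPc.zygmundPotHess K (hP1c hec') hSpos).add
      (hPc.zygmundPotDeriv K (hP2c hec' continuous_const) hSpos)
  have hGc : ContinuousOn (Function.uncurry G) S :=
    (hPc.zygmundPotHess K (hP1c hWI) hSpos).add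
      (hPc.zygmundPotDeriv K (hP2c hWI (hWI.mul continuous_const)) hSpos)
  have hm1 : ∀ r ∈ Ioo (-1 : ℝ) 1, HasDerivAt (fun r => ∫ θ in (0 : ℝ)..(2 * π), F0 r θ)
      (∫ θ in (0 : ℝ)..(2 * π), F1 r θ) r := by
    intro r hr
    refine hasDerivAt_intervalIntegral_of_continuousOn hr (hslice hF0c) hF1c fun x hx θ => ?_
    exact hasDerivAt_zygmundPot K ((toD hh _ (hWmem x hx θ)).harmonic_comp
      (w := fun x => W x θ) (toD hg _ (hWmem x hx θ)) (hWr x θ)) (hPpos x hx θ)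
  have hm2 : ∀ r ∈ Ioo (-1 : ℝ) 1, HasDerivAt (fun r => ∫ θ in (0 : ℝ)..(2 * π), F1 r θ)
      (∫ θ in (0 : ℝ)..(2 * π), F2 r θ) r := by
    intro r hr
    refine hasDerivAt_intervalIntegral_of_continuousOn hr (hslice hF1c) hF2c fun x hx θ => ?_
    exact hasDerivAt_zygmundPotDeriv K (p := fun x => P x θ) (q := fun x => P1 x θ (e θ))
      ((toD hh _ (hWmem x hx θ)).harmonic_comp (w := fun x => W x θ)
        (toD hg _ (hWmem x hx θ)) (hWr x θ))
      ((toD hh' _ (hWmem x hx θ)).harmonic_comp_mul (w := fun x => W x θ) (c := fun _ => e θ)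
        (toD hg' _ (hWmem x hx θ)) (hWr x θ) (hasDerivAt_const _ _)) (hPpos x hx θ)
  have hGint : ∀ r ∈ Ioo (-1 : ℝ) 1, ∫ θ in (0 : ℝ)..(2 * π), G r θ = 0 := by
    intro r hr
    rw [intervalIntegral.integral_eq_sub_of_hasDerivAt
      (f := fun θ => zygmundPotDeriv K (P r θ) (P1 r θ (W r θ * I))) (fun θ _ => ?_)
      ((hslice hGc r hr).intervalIntegrable _ _)]
    · have : W r (2 * π) = W r 0 := by simp [hW]
      simp only [hP, hP1, this, sub_self]
    · exact hasDerivAt_zygmundPotDeriv K (p := fun θ => P r θ)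
        (q := fun θ => P1 r θ (W r θ * I))
        ((toD hh _ (hWmem r hr θ)).harmonic_comp (toD hg _ (hWmem r hr θ)) (hWθ r θ))
        ((toD hh' _ (hWmem r hr θ)).harmonic_comp_mul (c := fun θ => W r θ * I)
          (toD hg' _ (hWmem r hr θ)) (hWθ r θ) ((hWθ r θ).mul_const I)) (hPpos r hr θ)
  have hpt : ∀ r ∈ Ioo (-1 : ℝ) 1, ∀ θ, 0 ≤ r * (F1 r θ + r * F2 r θ) + G r θ := by
    intro r hr θ
    have hnn := zygmundPotHess_add_nonneg hK (p := P r θ) (α := deriv h (W r θ) * W r θ)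
      (β := deriv g (W r θ) * W r θ) (hPpos r hr θ) (by
        rw [norm_mul (deriv h _), norm_mul (deriv g _), ← mul_assoc]
        refine mul_le_mul_of_nonneg_right ?_ (norm_nonneg (W r θ))
        exact hqr _ (hWmem r hr θ))
    have hWe : W r θ = r * e θ := rfl
    have e1 : deriv h (W r θ) * W r θ + (starRingEnd ℂ) (deriv g (W r θ) * W r θ)
        = r * P1 r θ (e θ) := by
      simp only [hP1, hWe, map_mul, Complex.conj_ofReal]
      ring
    have e2 : deriv h (W r θ) * W r θ * I + (starRingEnd ℂ) (deriv g (W r θ) * W r θ * I)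
        = P1 r θ (W r θ * I) := by
      simp only [hP1, mul_assoc]
    have e3 : P2 r θ (W r θ * I) (W r θ * I * I)
        = -((r ^ 2 : ℝ) * P2 r θ (e θ) 0 + r * P1 r θ (e θ)) := by
      have hI : I * I = -1 := Complex.I_mul_I
      simp only [hP1, hP2, mul_zero, map_zero, add_zero, hWe, map_mul, map_add, Complex.conj_ofReal,
        Complex.conj_I]
      push_cast
      linear_combination ((deriv (deriv h) (r * e θ) * (r * e θ) ^ 2)
        + deriv h (r * e θ) * (r * e θ)
        + (starRingEnd ℂ) (deriv (deriv g) (r * e θ)) * (r * (starRingEnd ℂ) (e θ)) ^ 2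
        + (starRingEnd ℂ) (deriv g (r * e θ)) * (r * (starRingEnd ℂ) (e θ))) * hI
    rw [e1, e2] at hnn
    have e4 : zygmundPotHess K (P r θ) (r * P1 r θ (e θ))
        = r ^ 2 * zygmundPotHess K (P r θ) (P1 r θ (e θ)) := by
      simp only [zygmundPotHess, Complex.re_ofReal_mul, Complex.im_ofReal_mul]
      ring
    have e5 : zygmundPotDeriv K (P r θ) (P2 r θ (W r θ * I) (W r θ * I * I))
        = -(r ^ 2 * zygmundPotDeriv K (P r θ) (P2 r θ (e θ) 0)
          + r * zygmundPotDeriv K (P r θ) (P1 r θ (e θ))) := by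
      rw [e3]
      simp only [zygmundPotDeriv, Complex.neg_re, Complex.neg_im, Complex.add_re, Complex.add_im,
        Complex.re_ofReal_mul, Complex.im_ofReal_mul]
      ring
    simp only [hF1, hF2, hG]
    rw [e5]
    rw [e4] at hnn
    linarith
  have hmono := monotoneOn_of_deriv_mul_nonneg hm1 hm2 (by
    intro r hr
    have hr' : r ∈ Ioo (-1 : ℝ) 1 := ⟨by linarith [hr.1], hr.2⟩
    have i1 := (hslice hF1c r hr').intervalIntegrable (μ := MeasureTheory.volume) 0 (2 * π)
    have i2 := (hslice hF2c r hr').intervalIntegrable (μ := MeasureTheory.volume) 0 (2 * π)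
    have i3 := (hslice hGc r hr').intervalIntegrable (μ := MeasureTheory.volume) 0 (2 * π)
    have hle : 0 ≤ ∫ θ in (0 : ℝ)..(2 * π), (r * (F1 r θ + r * F2 r θ) + G r θ) :=
      intervalIntegral.integral_nonneg (by positivity) fun θ _ => hpt r hr' θ
    rw [intervalIntegral.integral_add ((i1.add (i2.const_mul r)).const_mul r) i3, hGint r hr',
      intervalIntegral.integral_const_mul, intervalIntegral.integral_add i1 (i2.const_mul r),
      intervalIntegral.integral_const_mul, add_zero] at hle
    exact nonneg_of_mul_nonneg_right hle hr.1)
  have := hmono ⟨le_rfl, one_pos⟩ ⟨hr0.le, hr1⟩ hr0.le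
  simpa [hF0, hP, hW] using this

/-- Zygmund's theorem for harmonic `K`-quasiregular mappings (Theorem 1.1, case `u ≥ 1`). -/
theorem zygmund_quasiregular (K : ℝ) (hK : 1 ≤ K) (h g f : ℂ → ℂ) (u v : ℂ → ℝ)
    (hh : DifferentiableOn ℂ h unitDisk) (hg : DifferentiableOn ℂ g unitDisk)
    (hg0 : g 0 = 0)
    (hf : ∀ z ∈ unitDisk, f z = h z + (starRingEnd ℂ) (g z))
    (hqr : ∀ z ∈ unitDisk,
      deriv h z ≠ 0 ∧ ‖deriv g z‖ ≤ (K - 1) / (K + 1) * ‖deriv h z‖)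
    (hu : ∀ z, u z = (f z).re) (hv : ∀ z, v z = (f z).im)
    (hu1 : ∀ z ∈ unitDisk, 1 ≤ u z) (hv0 : v 0 = 0)
    (huZ : InZygmundClass u) :
    InHardy 1 f ∧
      ∀ r : ℝ, 0 < r → r < 1 →
        circleMean 1 f r ≤ K ^ 2 / (2 * π) * zygmundIntegral u r
          + |u 0| * (1 - K ^ 2 * Real.log |u 0|) := by
  have hmem : ∀ r : ℝ, 0 < r → r < 1 → ∀ θ : ℝ, (r : ℂ) * Complex.exp (θ * I) ∈ unitDisk :=
    fun r hr0 hr1 θ => ofReal_mul_exp_mem_unitDisk ⟨by linarith, hr1⟩ θ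
  have h0mem : (0 : ℂ) ∈ unitDisk := by simp [unitDisk]
  have hu' : ∀ z ∈ unitDisk, 1 ≤ (f z).re := fun z hz => hu z ▸ hu1 z hz
  have hfc : ContinuousOn f unitDisk :=
    (hh.continuousOn.add (Complex.continuous_conj.comp_continuousOn hg.continuousOn)).congr hf
  have hf0 : ‖f 0‖ = u 0 := by
    have him : (f 0).im = 0 := by rw [← hv, hv0]
    rw [Complex.norm_eq_sqrt_sq_add_sq, him, hu]
    simpa using Real.sqrt_sq (zero_le_one.trans (hu' 0 h0mem))
  have key : ∀ r : ℝ, 0 < r → r < 1 →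
      circleMean 1 f r ≤ K ^ 2 / (2 * π) * zygmundIntegral u r
        + |u 0| * (1 - K ^ 2 * Real.log |u 0|) := by
    intro r hr0 hr1
    have hfr : Continuous fun θ : ℝ => f (r * Complex.exp (θ * I)) :=
      hfc.comp_continuous (by fun_prop) (hmem r hr0 hr1)
    have hpos : ∀ θ : ℝ, (f (r * Complex.exp (θ * I))).re ≠ 0 := fun θ =>
      (zero_lt_one.trans_le (hu' _ (hmem r hr0 hr1 θ))).ne'
    have hlog : Continuous fun θ : ℝ =>
        (f (r * Complex.exp (θ * I))).re * Real.log (f (r * Complex.exp (θ * I))).re := by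
      have hre := Complex.continuous_re.comp hfr
      exact hre.mul (hre.log hpos)
    have hlogK : Continuous fun θ : ℝ => K ^ 2 *
        ((f (r * Complex.exp (θ * I))).re * Real.log (f (r * Complex.exp (θ * I))).re) :=
      continuous_const.mul hlog
    have hZ : zygmundIntegral u r = ∫ θ in (0 : ℝ)..(2 * π),
        (f (r * Complex.exp (θ * I))).re * Real.log (f (r * Complex.exp (θ * I))).re := by
      refine intervalIntegral.integral_congr fun θ _ => ?_
      have h1 := hu' _ (hmem r hr0 hr1 θ)
      simp only [hu, logPlus]
      rw [abs_of_nonneg (zero_le_one.trans h1), max_eq_left (Real.log_nonneg h1)]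
    have hmain := zygmundPot_le_integral hK hh hg (fun z hz => (hqr z hz).2)
      (fun z hz => hf z hz ▸ zero_lt_one.trans_le (hu' z hz)) hr0 hr1
    have hint : ∫ θ in (0 : ℝ)..(2 * π), zygmundPot K (h (r * Complex.exp (θ * I))
        + (starRingEnd ℂ) (g (r * Complex.exp (θ * I)))) = K ^ 2 * zygmundIntegral u r
          - ∫ θ in (0 : ℝ)..(2 * π), ‖f (r * Complex.exp (θ * I))‖ := by
      rw [hZ, ← intervalIntegral.integral_const_mul, ← intervalIntegral.integral_sub
        (hlogK.intervalIntegrable _ _) (hfr.norm.intervalIntegrable _ _)]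
      refine intervalIntegral.integral_congr fun θ _ => ?_
      simp only [zygmundPot]
      rw [← hf _ (hmem r hr0 hr1 θ)]
    rw [hint, ← hf 0 h0mem, zygmundPot, hf0, ← hu 0] at hmain
    have hπ : 0 < 2 * π := by positivity
    simp only [circleMean, Real.rpow_one, div_one]
    rw [abs_of_nonneg (zero_le_one.trans (hu1 0 h0mem)), ← mul_le_mul_iff_right₀ hπ]
    field_simp
    linarith
  refine ⟨?_, key⟩
  obtain ⟨C, hC⟩ := huZ
  refine ⟨K ^ 2 / (2 * π) * C + |u 0| * (1 - K ^ 2 * Real.log |u 0|), fun r hr0 hr1 => ?_⟩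
  refine (key r hr0 hr1).trans ?_
  gcongr
  exact hC r hr0 hr1
end
end

section
/- Let f = h + conj(g) be a harmonic K-quasiregular mapping in the unit disk 𝔻, write u = Re f and v = Im f, and assume u(z) ≤ −1 for all z ∈ 𝔻 and v(0) = 0. If u belongs to the class h·log⁺h, then f ∈ h¹, and for every 0 < r < 1, M₁(r,f) ≤ (K²/2π) ∫₀^{2π} |u(re^{iθ})| log⁺|u(re^{iθ})| dθ + |u(0)|·(1 − K² log|u(0)|). -/
open Complex Real Set

noncomputable section

/-- The open left half plane in `ℂ`, the domain of the exponential coordinate `w = log z` on the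
punctured unit disk. -/
def leftHalfPlane : Set ℂ := {w | w.re < 0}

lemma isOpen_leftHalfPlane : IsOpen leftHalfPlane :=
  isOpen_lt Complex.continuous_re continuous_const

lemma mem_leftHalfPlane {t : ℝ} (ht : t < 0) (θ : ℝ) : (t + θ * Complex.I : ℂ) ∈ leftHalfPlane := by
  simpa [leftHalfPlane] using ht

lemma continuous_vertical {P : ℂ → ℝ} (hP : ContinuousOn P leftHalfPlane) {t : ℝ} (ht : t < 0) :
    Continuous fun θ : ℝ => P (t + θ * Complex.I) :=
  hP.comp_continuous (by fun_prop) fun θ => mem_leftHalfPlane ht θ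

/-- Differentiation under the integral sign for integrals over vertical segments. -/
lemma hasDerivAt_integral_vertical {P P' : ℂ → ℝ} (hP : ContinuousOn P leftHalfPlane)
    (hP' : ContinuousOn P' leftHalfPlane)
    (hd : ∀ t θ : ℝ, t < 0 →
      HasDerivAt (fun s : ℝ => P (s + θ * Complex.I)) (P' (t + θ * Complex.I)) t)
    (a b : ℝ) {t : ℝ} (ht : t < 0) :
    HasDerivAt (fun s : ℝ => ∫ θ in a..b, P (s + θ * Complex.I))
      (∫ θ in a..b, P' (t + θ * Complex.I)) t := by
  have hcpt : IsCompact (Icc (2 * t) (t / 2) ×ˢ uIcc a b) := isCompact_Icc.prod isCompact_uIcc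
  have hcont : ContinuousOn (fun q : ℝ × ℝ => P' (q.1 + q.2 * Complex.I))
      (Icc (2 * t) (t / 2) ×ˢ uIcc a b) := by
    refine hP'.comp (by fun_prop) fun q hq => mem_leftHalfPlane ?_ _
    linarith [hq.1.2]
  obtain ⟨C, hC⟩ := hcpt.exists_bound_of_continuousOn hcont
  refine (intervalIntegral.hasDerivAt_integral_of_dominated_loc_of_deriv_le
    (F := fun (s θ : ℝ) => P (s + θ * Complex.I)) (F' := fun (s θ : ℝ) => P' (s + θ * Complex.I))
    (bound := fun _ => C)
    (Icc_mem_nhds (by linarith) (by linarith) : Icc (2 * t) (t / 2) ∈ nhds t) ?_ ?_ ?_ ?_ ?_ ?_).2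
  · filter_upwards [Iio_mem_nhds ht] with s hs
    exact (continuous_vertical hP hs).aestronglyMeasurable
  · exact (continuous_vertical hP ht).intervalIntegrable _ _
  · exact (continuous_vertical hP' ht).aestronglyMeasurable
  · exact Filter.Eventually.of_forall fun θ hθ s hs => hC (s, θ) ⟨hs, uIoc_subset_uIcc hθ⟩
  · exact intervalIntegrable_const
  · exact Filter.Eventually.of_forall fun θ _ s hs => hd s θ (by linarith [hs.2])

/-- A convex function on the negative half line is bounded below by its limit at `-∞`. -/
lemma ConvexOn.le_of_tendsto_atBot {m : ℝ → ℝ} {A : ℝ} (hm : ConvexOn ℝ (Iio 0) m)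
    (hA : Filter.Tendsto m Filter.atBot (nhds A)) {t : ℝ} (ht : t < 0) : A ≤ m t := by
  by_contra! hlt
  have hmid : (m t + A) / 2 < A := by linarith
  obtain ⟨t₁, h₁, ht₁⟩ := ((hA.eventually (lt_mem_nhds hmid)).and
    (Filter.eventually_lt_atBot t)).exists
  set d := m t₁ - m t with hd
  have hdpos : 0 < d := by linarith
  obtain ⟨s, ⟨hs, hs₁⟩, hs₂⟩ := (((hA.eventually (gt_mem_nhds (lt_add_one A))).and
    (Filter.eventually_lt_atBot t₁)).and (Filter.eventually_lt_atBot
      (t - (t - t₁) * (A + 1 - m t) / d))).exists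
  have hslope := hm.slope_mono_adjacent (x := s) (y := t₁) (z := t) (by simp; linarith)
    (by simpa using ht) hs₁ ht₁
  rw [div_le_div_iff₀ (by linarith) (by linarith)] at hslope
  have h2 : (t - t₁) * (A + 1 - m t) / d < t - s := by linarith
  rw [div_lt_iff₀ hdpos] at h2
  nlinarith

/-- The sub-mean value inequality for subharmonic functions in logarithmic coordinates: `Pt`, `Ptt`
and `Pθ`, `Pθθ` are the first and second derivatives of `P` in the two coordinate directions. -/
lemma le_integral_vertical_of_subharmonic {P Pt Ptt Pθ Pθθ : ℂ → ℝ} {A : ℝ}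
    (hP : ContinuousOn P leftHalfPlane) (hPt : ContinuousOn Pt leftHalfPlane)
    (hPtt : ContinuousOn Ptt leftHalfPlane) (hPθθ : ContinuousOn Pθθ leftHalfPlane)
    (dPt : ∀ t θ : ℝ, t < 0 →
      HasDerivAt (fun s : ℝ => P (s + θ * Complex.I)) (Pt (t + θ * Complex.I)) t)
    (dPtt : ∀ t θ : ℝ, t < 0 →
      HasDerivAt (fun s : ℝ => Pt (s + θ * Complex.I)) (Ptt (t + θ * Complex.I)) t)
    (dPθθ : ∀ t θ : ℝ, t < 0 →
      HasDerivAt (fun s : ℝ => Pθ (t + s * Complex.I)) (Pθθ (t + θ * Complex.I)) θ)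
    (hper : ∀ t : ℝ, t < 0 → Pθ (t + (2 * π : ℝ) * Complex.I) = Pθ (t + (0 : ℝ) * Complex.I))
    (hsub : ∀ w ∈ leftHalfPlane, 0 ≤ Ptt w + Pθθ w)
    (hA : Filter.Tendsto (fun t : ℝ => ∫ θ in (0:ℝ)..(2 * π), P (t + θ * Complex.I))
      Filter.atBot (nhds A)) {t : ℝ} (ht : t < 0) :
    A ≤ ∫ θ in (0:ℝ)..(2 * π), P (t + θ * Complex.I) := by
  refine ConvexOn.le_of_tendsto_atBot ?_ hA ht
  have d1 := fun s (hs : s < 0) => hasDerivAt_integral_vertical hP hPt dPt 0 (2 * π) hs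
  have d2 := fun s (hs : s < 0) => hasDerivAt_integral_vertical hPt hPtt dPtt 0 (2 * π) hs
  refine convexOn_of_hasDerivWithinAt2_nonneg (convex_Iio 0)
    (fun s hs => (d1 s hs).continuousAt.continuousWithinAt)
    (fun s hs => (d1 s (by simpa using hs)).hasDerivWithinAt)
    (fun s hs => (d2 s (by simpa using hs)).hasDerivWithinAt) fun s hs => ?_
  have hs : s < 0 := by simpa using hs
  have hzero : ∫ θ in (0:ℝ)..(2 * π), Pθθ (s + θ * Complex.I) = 0 := by
    rw [intervalIntegral.integral_eq_sub_of_hasDerivAt (fun θ _ => dPθθ s θ hs)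
      ((continuous_vertical hPθθ hs).intervalIntegrable _ _), hper s hs, sub_self]
  have hadd := intervalIntegral.integral_add
    ((continuous_vertical hPtt hs).intervalIntegrable (μ := MeasureTheory.volume) 0 (2 * π))
    ((continuous_vertical hPθθ hs).intervalIntegrable 0 (2 * π))
  rw [hzero, add_zero] at hadd
  rw [← hadd]
  exact intervalIntegral.integral_nonneg (by positivity) fun θ _ => hsub _ (mem_leftHalfPlane hs θ)

/-- The comparison function `K² |x| log |x| - |z|`, `x = Re z`, on the half plane `Re z < 0`. -/
def zygmundAux (K : ℝ) (z : ℂ) : ℝ := K ^ 2 * (-z.re * Real.log (-z.re)) - ‖z‖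

/-- The derivative of `zygmundAux K` at `z` in the direction `p`. -/
def zygmundAuxD (K : ℝ) (z p : ℂ) : ℝ :=
  -(K ^ 2 * (p.re * (Real.log (-z.re) + 1))) - (z.re * p.re + z.im * p.im) / ‖z‖

/-- The second derivative of `zygmundAux K` along a curve through `z` with velocity `p` and
acceleration `s`. -/
def zygmundAuxDD (K : ℝ) (z p s : ℂ) : ℝ :=
  K ^ 2 * (p.re ^ 2 / (-z.re) - s.re * (Real.log (-z.re) + 1)) -
    ((p.re ^ 2 + p.im ^ 2 + (z.re * s.re + z.im * s.im)) / ‖z‖ -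
      (z.re * p.re + z.im * p.im) ^ 2 / ‖z‖ ^ 3)

lemma norm_pos_of_re_neg {z : ℂ} (hz : z.re < 0) : 0 < ‖z‖ :=
  norm_pos_iff.2 fun h => by simp [h] at hz

section Curves

variable {γ : ℝ → ℂ} {x : ℝ}

lemma HasDerivAt.complex_re_s1 {p : ℂ} (hγ : HasDerivAt γ p x) :
    HasDerivAt (fun y => (γ y).re) p.re x :=
  Complex.reCLM.hasFDerivAt.comp_hasDerivAt x hγ

lemma HasDerivAt.complex_im_s1 {p : ℂ} (hγ : HasDerivAt γ p x) :
    HasDerivAt (fun y => (γ y).im) p.im x :=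
  Complex.imCLM.hasFDerivAt.comp_hasDerivAt x hγ

lemma HasDerivAt.norm_of_re_neg {p : ℂ} (hγ : HasDerivAt γ p x) (hx : (γ x).re < 0) :
    HasDerivAt (fun y => ‖γ y‖) (((γ x).re * p.re + (γ x).im * p.im) / ‖γ x‖) x := by
  have hpos := norm_pos_of_re_neg hx
  have hsq : ∀ z : ℂ, z.re ^ 2 + z.im ^ 2 = ‖z‖ ^ 2 := fun z => by
    rw [← Complex.normSq_eq_norm_sq, Complex.normSq_apply]; ring
  have h := ((hγ.complex_re_s1.pow 2).add (hγ.complex_im_s1.pow 2)).sqrt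
    (by simp only [Pi.add_apply, Pi.pow_apply]; rw [hsq]; positivity)
  have e : (fun y => ‖γ y‖) = fun y => √(((fun y => (γ y).re) ^ 2 + (fun y => (γ y).im) ^ 2) y) := by
    funext y
    simp only [Pi.add_apply, Pi.pow_apply]
    rw [hsq, Real.sqrt_sq (norm_nonneg _)]
  rw [e]
  convert h using 1
  simp only [Pi.add_apply, Pi.pow_apply]
  rw [hsq, Real.sqrt_sq (norm_nonneg _)]
  field_simp
  ring

lemma hasDerivAt_log_neg_re {p : ℂ} (hγ : HasDerivAt γ p x) (hx : (γ x).re < 0) :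
    HasDerivAt (fun y => Real.log (-(γ y).re)) (-p.re / (-(γ x).re)) x :=
  hγ.complex_re_s1.fun_neg.log (by linarith)

lemma hasDerivAt_zygmundAux (K : ℝ) {p : ℂ} (hγ : HasDerivAt γ p x) (hx : (γ x).re < 0) :
    HasDerivAt (fun y => zygmundAux K (γ y)) (zygmundAuxD K (γ x) p) x := by
  have h := ((hγ.complex_re_s1.fun_neg.fun_mul (hasDerivAt_log_neg_re hγ hx)).const_mul
    (K ^ 2)).fun_sub (hγ.norm_of_re_neg hx)
  refine h.congr_deriv ?_
  have := hx.ne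
  rw [zygmundAuxD]
  field_simp
  ring

lemma hasDerivAt_zygmundAuxD (K : ℝ) {δ : ℝ → ℂ} {s : ℂ} (hγ : HasDerivAt γ (δ x) x)
    (hδ : HasDerivAt δ s x) (hx : (γ x).re < 0) :
    HasDerivAt (fun y => zygmundAuxD K (γ y) (δ y)) (zygmundAuxDD K (γ x) (δ x) s) x := by
  have hpos := norm_pos_of_re_neg hx
  have h := ((hδ.complex_re_s1.fun_mul ((hasDerivAt_log_neg_re hγ hx).add_const 1)).const_mul
    (K ^ 2)).fun_neg.fun_sub (((hγ.complex_re_s1.fun_mul hδ.complex_re_s1).fun_add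
      (hγ.complex_im_s1.fun_mul hδ.complex_im_s1)).fun_div (hγ.norm_of_re_neg hx) hpos.ne')
  refine h.congr_deriv ?_
  have := hx.ne
  rw [zygmundAuxDD]
  field_simp
  ring

end Curves

section Continuity

variable {X : Type*} [TopologicalSpace X] {S : Set X} {a b c : X → ℂ}

lemma continuousOn_zygmundAux (K : ℝ) (ha : ContinuousOn a S) (hneg : ∀ x ∈ S, (a x).re < 0) :
    ContinuousOn (fun x => zygmundAux K (a x)) S := by
  have hlog : ContinuousOn (fun x => Real.log (-(a x).re)) S :=
    ContinuousOn.log (by fun_prop) fun x hx => by linarith [hneg x hx]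
  unfold zygmundAux
  fun_prop

lemma continuousOn_zygmundAuxD (K : ℝ) (ha : ContinuousOn a S) (hb : ContinuousOn b S)
    (hneg : ∀ x ∈ S, (a x).re < 0) : ContinuousOn (fun x => zygmundAuxD K (a x) (b x)) S := by
  have hlog : ContinuousOn (fun x => Real.log (-(a x).re)) S :=
    ContinuousOn.log (by fun_prop) fun x hx => by linarith [hneg x hx]
  have hnorm : ∀ x ∈ S, ‖a x‖ ≠ 0 := fun x hx => (norm_pos_of_re_neg (hneg x hx)).ne'
  unfold zygmundAuxD
  fun_prop (disch := assumption)

lemma continuousOn_zygmundAuxDD (K : ℝ) (ha : ContinuousOn a S) (hb : ContinuousOn b S)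
    (hc : ContinuousOn c S) (hneg : ∀ x ∈ S, (a x).re < 0) :
    ContinuousOn (fun x => zygmundAuxDD K (a x) (b x) (c x)) S := by
  have hlog : ContinuousOn (fun x => Real.log (-(a x).re)) S :=
    ContinuousOn.log (by fun_prop) fun x hx => by linarith [hneg x hx]
  have hnorm : ∀ x ∈ S, ‖a x‖ ≠ 0 := fun x hx => (norm_pos_of_re_neg (hneg x hx)).ne'
  have hnorm3 : ∀ x ∈ S, ‖a x‖ ^ 3 ≠ 0 := fun x hx => pow_ne_zero 3 (hnorm x hx)
  have hre : ∀ x ∈ S, -(a x).re ≠ 0 := fun x hx => by linarith [hneg x hx]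
  unfold zygmundAuxDD
  fun_prop (disch := assumption)

end Continuity

/-- Nonnegativity of the Laplacian of `zygmundAux K ∘ f` for a `K`-quasiregular harmonic `f`; here
`a` and `b` are the derivatives of the analytic and the co-analytic part of `f`. -/
lemma zygmundAuxDD_add_nonneg {K : ℝ} {z a b : ℂ} (s : ℂ) (hz : z.re < 0)
    (hab : (K + 1) * ‖b‖ ≤ (K - 1) * ‖a‖) :
    0 ≤ zygmundAuxDD K z (a + (starRingEnd ℂ) b) s +
      zygmundAuxDD K z (Complex.I * a + (starRingEnd ℂ) (Complex.I * b)) (-s) := by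
  have hpos := norm_pos_of_re_neg hz
  have hsq : ∀ z : ℂ, z.re ^ 2 + z.im ^ 2 = ‖z‖ ^ 2 := fun z => by
    rw [← Complex.normSq_eq_norm_sq, Complex.normSq_apply]; ring
  have hle : -z.re ≤ ‖z‖ := (neg_le_abs _).trans (Complex.abs_re_le_norm z)
  have hD : (‖a‖ + ‖b‖) ^ 2 ≤ K ^ 2 * (‖a‖ - ‖b‖) ^ 2 := by
    rw [← mul_pow]
    exact pow_le_pow_left₀ (by positivity) (by linarith) 2
  have h1 : (‖a‖ - ‖b‖) ^ 2 ≤ ‖a + b‖ ^ 2 := by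
    refine sq_le_sq.2 ?_
    simpa using abs_norm_sub_norm_le a (-b)
  have h2 : (‖a‖ - ‖b‖) ^ 2 * ‖z‖ ^ 2 ≤ ‖(starRingEnd ℂ) z * a + z * b‖ ^ 2 := by
    rw [← mul_pow]
    refine sq_le_sq.2 ?_
    have := abs_norm_sub_norm_le ((starRingEnd ℂ) z * a) (-(z * b))
    rw [norm_neg, norm_mul, norm_mul, RCLike.norm_conj, sub_neg_eq_add] at this
    rw [abs_of_nonneg (norm_nonneg ((starRingEnd ℂ) z * a + z * b))]
    rwa [show (‖a‖ - ‖b‖) * ‖z‖ = ‖z‖ * ‖a‖ - ‖z‖ * ‖b‖ by ring]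
  have key : zygmundAuxDD K z (a + (starRingEnd ℂ) b) s +
      zygmundAuxDD K z (Complex.I * a + (starRingEnd ℂ) (Complex.I * b)) (-s) =
      K ^ 2 * ‖a + b‖ ^ 2 / (-z.re) - (2 * ‖a‖ ^ 2 + 2 * ‖b‖ ^ 2) / ‖z‖ +
        ‖(starRingEnd ℂ) z * a + z * b‖ ^ 2 / ‖z‖ ^ 3 := by
    rw [← hsq (a + b), ← hsq ((starRingEnd ℂ) z * a + z * b), ← hsq a, ← hsq b]
    simp only [zygmundAuxDD, Complex.add_re, Complex.add_im, Complex.mul_re, Complex.mul_im,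
      Complex.conj_re, Complex.conj_im, Complex.I_re, Complex.I_im, Complex.neg_re, Complex.neg_im]
    have := hz.ne
    field_simp
    ring
  rw [key]
  have e1 : K ^ 2 * (‖a‖ - ‖b‖) ^ 2 / ‖z‖ ≤ K ^ 2 * ‖a + b‖ ^ 2 / (-z.re) := by
    have : 0 < -z.re := by linarith
    gcongr
  have e2 : (‖a‖ - ‖b‖) ^ 2 / ‖z‖ ≤ ‖(starRingEnd ℂ) z * a + z * b‖ ^ 2 / ‖z‖ ^ 3 := by
    rw [div_le_div_iff₀ hpos (by positivity)]
    nlinarith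
  have e3 : (2 * ‖a‖ ^ 2 + 2 * ‖b‖ ^ 2) / ‖z‖ ≤
      K ^ 2 * (‖a‖ - ‖b‖) ^ 2 / ‖z‖ + (‖a‖ - ‖b‖) ^ 2 / ‖z‖ := by
    rw [← add_div]
    exact div_le_div_of_nonneg_right (by nlinarith) hpos.le
  linarith

section HolomorphicCurves

variable {H : ℂ → ℂ} {H' : ℂ} {t θ : ℝ}

lemma HasDerivAt.comp_horizontal (hH : HasDerivAt H H' (t + θ * Complex.I)) :
    HasDerivAt (fun s : ℝ => H (s + θ * Complex.I)) H' t := by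
  have h : HasDerivAt (fun s : ℝ => (s + θ * Complex.I : ℂ)) 1 t :=
    (HasDerivAt.ofReal_comp (hasDerivAt_id t)).add_const _
  exact (hH.comp t h).congr_deriv (mul_one _)

lemma HasDerivAt.comp_vertical (hH : HasDerivAt H H' (t + θ * Complex.I)) :
    HasDerivAt (fun s : ℝ => H (t + s * Complex.I)) (Complex.I * H') θ := by
  have h : HasDerivAt (fun s : ℝ => (t + s * Complex.I : ℂ)) Complex.I θ := by
    simpa using ((HasDerivAt.ofReal_comp (hasDerivAt_id θ)).mul_const Complex.I).const_add (t : ℂ)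
  exact (hH.comp θ h).congr_deriv (mul_comm _ _)

lemma HasDerivAt.add_conj {γ δ : ℝ → ℂ} {p q : ℂ} {x : ℝ} (hγ : HasDerivAt γ p x)
    (hδ : HasDerivAt δ q x) :
    HasDerivAt (fun y => γ y + (starRingEnd ℂ) (δ y)) (p + (starRingEnd ℂ) q) x :=
  hγ.fun_add (Complex.conjCLE.hasFDerivAt.comp_hasDerivAt x hδ)

end HolomorphicCurves

lemma exp_mem_unitDisk {w : ℂ} (hw : w ∈ leftHalfPlane) : Complex.exp w ∈ unitDisk := by
  simpa [unitDisk, leftHalfPlane, Complex.norm_exp] using hw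

lemma exp_add_two_pi_mul_I (t : ℝ) : Complex.exp (t + (2 * π : ℝ) * Complex.I) =
    Complex.exp (t + (0 : ℝ) * Complex.I) := by
  have := Complex.exp_periodic (t : ℂ)
  simpa using this

lemma deriv_comp_exp {h : ℂ → ℂ} (hh : DifferentiableOn ℂ h unitDisk) {w : ℂ}
    (hw : w ∈ leftHalfPlane) :
    deriv (fun w => h (Complex.exp w)) w = deriv h (Complex.exp w) * Complex.exp w :=
  ((hh.differentiableAt (Metric.isOpen_ball.mem_nhds (exp_mem_unitDisk hw))).hasDerivAt.comp w
    (Complex.hasDerivAt_exp w)).deriv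

lemma differentiableOn_comp_exp {h : ℂ → ℂ} (hh : DifferentiableOn ℂ h unitDisk) :
    DifferentiableOn ℂ (fun w => h (Complex.exp w)) leftHalfPlane :=
  hh.comp Complex.differentiable_exp.differentiableOn fun _ hw => exp_mem_unitDisk hw

/-- Circle averages of a function continuous at the origin converge to its central value. -/
lemma tendsto_integral_exp_atBot {φ : ℂ → ℝ} (hφ : ContinuousOn φ unitDisk) :
    Filter.Tendsto (fun t : ℝ => ∫ θ in (0:ℝ)..(2 * π), φ (Complex.exp (t + θ * Complex.I)))
      Filter.atBot (nhds (2 * π * φ 0)) := by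
  have hc : ContinuousAt φ 0 :=
    hφ.continuousAt (Metric.isOpen_ball.mem_nhds (by simp))
  have hpt : ∀ θ : ℝ, Filter.Tendsto (fun t : ℝ => Complex.exp (t + θ * Complex.I))
      Filter.atBot (nhds 0) := fun θ => by
    rw [tendsto_zero_iff_norm_tendsto_zero]
    simpa [Complex.norm_exp] using Real.tendsto_exp_atBot
  obtain ⟨δ, hδ, hball⟩ := Metric.continuousAt_iff.1 hc 1 one_pos
  have hlim : ∫ _ in (0:ℝ)..(2 * π), φ 0 = 2 * π * φ 0 := by simp
  rw [← hlim]
  refine intervalIntegral.tendsto_integral_filter_of_dominated_convergence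
    (fun _ => |φ 0| + 1) ?_ ?_ intervalIntegrable_const ?_
  · filter_upwards [Filter.eventually_lt_atBot (0 : ℝ)] with t ht
    have hcont : ContinuousOn (fun w => φ (Complex.exp w)) leftHalfPlane :=
      hφ.comp Complex.continuous_exp.continuousOn fun _ hw => exp_mem_unitDisk hw
    exact (continuous_vertical hcont ht).aestronglyMeasurable
  · filter_upwards [Real.tendsto_exp_atBot.eventually (gt_mem_nhds hδ)] with t ht
    refine Filter.Eventually.of_forall fun θ _ => ?_
    have := hball (x := Complex.exp (t + θ * Complex.I)) (by simpa [Complex.norm_exp] using ht)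
    rw [Real.dist_eq] at this
    rw [Real.norm_eq_abs]
    linarith [abs_sub_abs_le_abs_sub (φ (Complex.exp (t + θ * Complex.I))) (φ 0)]
  · exact Filter.Eventually.of_forall fun θ _ => hc.tendsto.comp (hpt θ)

/-- The sub-mean value inequality for `zygmundAux K ∘ f`, with `f = h + conj g` harmonic and
`K`-quasiregular with negative real part. -/
lemma zygmundAux_le_integral {K : ℝ} (hK : 1 ≤ K) {h g : ℂ → ℂ}
    (hh : DifferentiableOn ℂ h unitDisk) (hg : DifferentiableOn ℂ g unitDisk)
    (hqr : ∀ z ∈ unitDisk, ‖deriv g z‖ ≤ (K - 1) / (K + 1) * ‖deriv h z‖)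
    (hneg : ∀ z ∈ unitDisk, (h z + (starRingEnd ℂ) (g z)).re < 0) {t : ℝ} (ht : t < 0) :
    2 * π * zygmundAux K (h 0 + (starRingEnd ℂ) (g 0)) ≤
      ∫ θ in (0:ℝ)..(2 * π), zygmundAux K (h (Complex.exp (t + θ * Complex.I)) +
        (starRingEnd ℂ) (g (Complex.exp (t + θ * Complex.I)))) := by
  set H : ℂ → ℂ := fun w => h (Complex.exp w) with hH
  set G : ℂ → ℂ := fun w => g (Complex.exp w) with hG
  have dH : DifferentiableOn ℂ H leftHalfPlane := differentiableOn_comp_exp hh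
  have dG : DifferentiableOn ℂ G leftHalfPlane := differentiableOn_comp_exp hg
  have dH' := dH.deriv isOpen_leftHalfPlane
  have dG' := dG.deriv isOpen_leftHalfPlane
  have cH := dH.continuousOn
  have cG := dG.continuousOn
  have cH' := dH'.continuousOn
  have cG' := dG'.continuousOn
  have cH'' := (dH'.deriv isOpen_leftHalfPlane).continuousOn
  have cG'' := (dG'.deriv isOpen_leftHalfPlane).continuousOn
  have hasD : ∀ {F : ℂ → ℂ}, DifferentiableOn ℂ F leftHalfPlane → ∀ t θ : ℝ, t < 0 →
      HasDerivAt F (deriv F (t + θ * Complex.I)) (t + θ * Complex.I) := fun hF t θ ht =>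
    (hF.differentiableAt (isOpen_leftHalfPlane.mem_nhds (mem_leftHalfPlane ht θ))).hasDerivAt
  have conjc : ∀ {F : ℂ → ℂ}, ContinuousOn F leftHalfPlane →
      ContinuousOn (fun w => (starRingEnd ℂ) (F w)) leftHalfPlane := fun hF =>
    Complex.continuous_conj.comp_continuousOn hF
  have cf : ContinuousOn (fun w => H w + (starRingEnd ℂ) (G w)) leftHalfPlane := cH.add (conjc cG)
  have cp : ContinuousOn (fun w => deriv H w + (starRingEnd ℂ) (deriv G w)) leftHalfPlane :=
    cH'.add (conjc cG')
  have cs : ContinuousOn (fun w => deriv (deriv H) w + (starRingEnd ℂ) (deriv (deriv G) w))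
      leftHalfPlane := cH''.add (conjc cG'')
  have cq : ContinuousOn (fun w => Complex.I * deriv H w +
      (starRingEnd ℂ) (Complex.I * deriv G w)) leftHalfPlane :=
    (continuousOn_const.mul cH').add (conjc (continuousOn_const.mul cG'))
  have hfneg : ∀ w ∈ leftHalfPlane, (H w + (starRingEnd ℂ) (G w)).re < 0 :=
    fun w hw => hneg _ (exp_mem_unitDisk hw)
  have hA := tendsto_integral_exp_atBot (φ := fun z => zygmundAux K (h z + (starRingEnd ℂ) (g z)))
    (continuousOn_zygmundAux K (hh.continuousOn.add
      (Complex.continuous_conj.comp_continuousOn hg.continuousOn)) hneg)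
  refine le_integral_vertical_of_subharmonic
    (P := fun w => zygmundAux K (H w + (starRingEnd ℂ) (G w)))
    (Pt := fun w => zygmundAuxD K (H w + (starRingEnd ℂ) (G w))
      (deriv H w + (starRingEnd ℂ) (deriv G w)))
    (Ptt := fun w => zygmundAuxDD K (H w + (starRingEnd ℂ) (G w))
      (deriv H w + (starRingEnd ℂ) (deriv G w))
      (deriv (deriv H) w + (starRingEnd ℂ) (deriv (deriv G) w)))
    (Pθ := fun w => zygmundAuxD K (H w + (starRingEnd ℂ) (G w))
      (Complex.I * deriv H w + (starRingEnd ℂ) (Complex.I * deriv G w)))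
    (Pθθ := fun w => zygmundAuxDD K (H w + (starRingEnd ℂ) (G w))
      (Complex.I * deriv H w + (starRingEnd ℂ) (Complex.I * deriv G w))
      (-(deriv (deriv H) w + (starRingEnd ℂ) (deriv (deriv G) w))))
    (continuousOn_zygmundAux K cf hfneg) (continuousOn_zygmundAuxD K cf cp hfneg)
    (continuousOn_zygmundAuxDD K cf cp cs hfneg) (continuousOn_zygmundAuxDD K cf cq cs.neg hfneg)
    ?_ ?_ ?_ ?_ ?_ hA ht
  · intro t θ ht
    exact hasDerivAt_zygmundAux K
      ((hasD dH t θ ht).comp_horizontal.add_conj (hasD dG t θ ht).comp_horizontal)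
      (hfneg _ (mem_leftHalfPlane ht θ))
  · intro t θ ht
    exact hasDerivAt_zygmundAuxD K
      (δ := fun s => deriv H (s + θ * Complex.I) +
        (starRingEnd ℂ) (deriv G (s + θ * Complex.I)))
      ((hasD dH t θ ht).comp_horizontal.add_conj (hasD dG t θ ht).comp_horizontal)
      ((hasD dH' t θ ht).comp_horizontal.add_conj (hasD dG' t θ ht).comp_horizontal)
      (hfneg _ (mem_leftHalfPlane ht θ))
  · intro t θ ht
    refine hasDerivAt_zygmundAuxD K
      (γ := fun s => H (t + s * Complex.I) + (starRingEnd ℂ) (G (t + s * Complex.I)))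
      (δ := fun s => Complex.I * deriv H (t + s * Complex.I) +
        (starRingEnd ℂ) (Complex.I * deriv G (t + s * Complex.I)))
      ((hasD dH t θ ht).comp_vertical.add_conj (hasD dG t θ ht).comp_vertical)
      ((((hasD dH' t θ ht).comp_vertical.const_mul Complex.I).add_conj
        ((hasD dG' t θ ht).comp_vertical.const_mul Complex.I)).congr_deriv ?_)
      (hfneg _ (mem_leftHalfPlane ht θ))
    rw [← mul_assoc, ← mul_assoc, Complex.I_mul_I, neg_one_mul, neg_one_mul, map_neg, neg_add]
  · intro t ht
    simp only [hH, hG, deriv_comp_exp hh (mem_leftHalfPlane ht _),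
      deriv_comp_exp hg (mem_leftHalfPlane ht _), exp_add_two_pi_mul_I]
  · intro w hw
    refine zygmundAuxDD_add_nonneg _ (hfneg w hw) ?_
    rw [hH, hG, deriv_comp_exp hh hw, deriv_comp_exp hg hw, norm_mul, norm_mul, ← mul_assoc,
      ← mul_assoc]
    refine mul_le_mul_of_nonneg_right ?_ (norm_nonneg _)
    have := hqr _ (exp_mem_unitDisk hw)
    rw [div_mul_eq_mul_div, le_div_iff₀ (by linarith)] at this
    linarith

/-- Zygmund's theorem for harmonic `K`-quasiregular mappings (Theorem 1.1, case `u ≤ -1`). -/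
theorem zygmund_quasiregular_neg (K : ℝ) (hK : 1 ≤ K) (h g f : ℂ → ℂ) (u v : ℂ → ℝ)
    (hh : DifferentiableOn ℂ h unitDisk) (hg : DifferentiableOn ℂ g unitDisk)
    (hg0 : g 0 = 0)
    (hf : ∀ z ∈ unitDisk, f z = h z + (starRingEnd ℂ) (g z))
    (hqr : ∀ z ∈ unitDisk,
      deriv h z ≠ 0 ∧ ‖deriv g z‖ ≤ (K - 1) / (K + 1) * ‖deriv h z‖)
    (hu : ∀ z, u z = (f z).re) (hv : ∀ z, v z = (f z).im)
    (hu1 : ∀ z ∈ unitDisk, u z ≤ -1) (hv0 : v 0 = 0)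
    (huZ : InZygmundClass u) :
    InHardy 1 f ∧
      ∀ r : ℝ, 0 < r → r < 1 →
        circleMean 1 f r ≤ K ^ 2 / (2 * π) * zygmundIntegral u r
          + |u 0| * (1 - K ^ 2 * Real.log |u 0|) := by
  have bound : ∀ r : ℝ, 0 < r → r < 1 →
      circleMean 1 f r ≤ K ^ 2 / (2 * π) * zygmundIntegral u r
        + |u 0| * (1 - K ^ 2 * Real.log |u 0|) := by
    intro r hr hr1
    have h0 : (0 : ℂ) ∈ unitDisk := by simp [unitDisk]
    have hmem : ∀ θ : ℝ, (r * Complex.exp (θ * Complex.I) : ℂ) ∈ unitDisk := fun θ => by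
      simpa [unitDisk, Complex.norm_exp, abs_of_pos hr] using hr1
    have hmain := zygmundAux_le_integral hK hh hg (fun z hz => (hqr z hz).2)
      (fun z hz => by rw [← hf z hz, ← hu]; linarith [hu1 z hz]) (Real.log_neg hr hr1)
    have hexp : ∀ θ : ℝ, Complex.exp (Real.log r + θ * Complex.I) =
        r * Complex.exp (θ * Complex.I) := fun θ => by
      rw [Complex.exp_add, ← Complex.ofReal_exp, Real.exp_log hr]
    simp only [hexp, ← hf _ (hmem _), ← hf 0 h0] at hmain
    have haux : ∀ z ∈ unitDisk, zygmundAux K (f z) =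
        K ^ 2 * (|u z| * logPlus |u z|) - ‖f z‖ := fun z hz => by
      have hz1 := hu1 z hz
      have habs : |u z| = -u z := abs_of_neg (by linarith)
      rw [zygmundAux, ← hu, habs, logPlus, max_eq_left (Real.log_nonneg (by linarith))]
    have hnorm0 : ‖f 0‖ = |u 0| := by
      rw [hu, Complex.abs_re_eq_norm.2 (by rw [← hv, hv0])]
    have hzero : zygmundAux K (f 0) = K ^ 2 * (|u 0| * Real.log |u 0|) - |u 0| := by
      have h1 := hu1 0 h0
      rw [haux 0 h0, hnorm0, logPlus, max_eq_left (Real.log_nonneg _)]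
      rw [abs_of_neg (by linarith)]
      linarith
    have cf : Continuous fun θ : ℝ => f (r * Complex.exp (θ * Complex.I)) := by
      have : ContinuousOn f unitDisk := (hh.continuousOn.add
        (Complex.continuous_conj.comp_continuousOn hg.continuousOn)).congr hf
      exact this.comp_continuous (by fun_prop) hmem
    have ca : Continuous fun θ : ℝ => |u (r * Complex.exp (θ * Complex.I))| *
        logPlus |u (r * Complex.exp (θ * Complex.I))| := by
      simp only [logPlus, hu]
      have hre : Continuous fun θ : ℝ => |(f (r * Complex.exp (θ * Complex.I))).re| :=
        (Complex.continuous_re.comp cf).abs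
      refine hre.mul ((hre.log fun θ => ?_).max continuous_const)
      rw [← hu]
      exact abs_ne_zero.2 (by linarith [hu1 _ (hmem θ)])
    simp only [haux _ (hmem _), hzero] at hmain
    rw [intervalIntegral.integral_sub ((ca.const_mul _).intervalIntegrable _ _)
      (cf.norm.intervalIntegrable _ _), intervalIntegral.integral_const_mul] at hmain
    simp only [circleMean, zygmundIntegral, Real.rpow_one, div_one]
    have hπ : 0 < 2 * π := by positivity
    generalize (∫ θ in (0:ℝ)..(2 * π), ‖f (r * Complex.exp (θ * Complex.I))‖) = M at hmain ⊢
    generalize (∫ θ in (0:ℝ)..(2 * π), |u (r * Complex.exp (θ * Complex.I))| *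
      logPlus |u (r * Complex.exp (θ * Complex.I))|) = Z at hmain ⊢
    rw [← sub_nonneg] at hmain ⊢
    refine (div_nonneg hmain hπ.le).trans_eq ?_
    field_simp
    ring
  refine ⟨?_, bound⟩
  obtain ⟨C, hC⟩ := huZ
  refine ⟨K ^ 2 / (2 * π) * C + |u 0| * (1 - K ^ 2 * Real.log |u 0|), fun r hr hr1 =>
    (bound r hr hr1).trans ?_⟩
  have := hC r hr hr1
  gcongr
end
end

section
/- Let f = h + conj(g) be a harmonic function in the unit disk 𝔻 (h, g analytic in 𝔻, g(0)=0) such that Re f(z) ≥ C for all z ∈ 𝔻 for some real constant C, and such that Im h(z) ≠ 0 for all z ∈ 𝔻. If f ∈ h¹, then Re f belongs to the class h·log⁺h. -/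
open Complex Real Set

noncomputable section

/-- The mean value property over circles compactly contained in the disk. -/
lemma circleAverage_re_of_differentiableOn {Φ : ℂ → ℂ} (hΦ : DifferentiableOn ℂ Φ unitDisk)
    {r : ℝ} (hr0 : 0 < r) (hr1 : r < 1) :
    circleAverage (fun z => (Φ z).re) 0 r = (Φ 0).re := by
  have hsub : Metric.closedBall (0 : ℂ) r ⊆ unitDisk := Metric.closedBall_subset_ball hr1
  have hcl : DiffContOnCl ℂ Φ (Metric.ball 0 |r|) := by
    rw [abs_of_pos hr0]
    exact (hΦ.mono hsub).diffContOnCl_ball subset_rfl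
  have hint : CircleIntegrable Φ 0 r :=
    (hΦ.continuousOn.mono (Metric.sphere_subset_closedBall.trans hsub)).circleIntegrable hr0.le
  have := Complex.reCLM.circleAverage_comp_comm hint
  rw [hcl.circleAverage] at this
  exact this

lemma zygmundIntegral_eq_circleAverage (u : ℂ → ℝ) (r : ℝ) :
    zygmundIntegral u r = 2 * π * circleAverage (fun z => |u z| * logPlus |u z|) 0 r := by
  simp only [zygmundIntegral, circleAverage_def, circleMap, zero_add, smul_eq_mul]
  rw [mul_inv_cancel_left₀ two_pi_pos.ne']

lemma circleMean_one_eq_circleAverage (f : ℂ → ℂ) (r : ℝ) :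
    circleMean 1 f r = circleAverage (fun z => ‖f z‖) 0 r := by
  simp [circleMean, circleAverage_def, circleMap]

lemma continuous_abs_mul_logPlus_abs : Continuous fun x : ℝ => |x| * logPlus |x| := by
  have : logPlus = posLog := by
    ext x
    exact max_comm _ _
  rw [this]
  exact continuous_abs.mul (Real.continuous_posLog.comp continuous_abs)

/-- `Re w log (Re w)` is controlled by the real part of the analytic function `w log w`. -/
lemma re_mul_log_re_le {w : ℂ} (hw : 1 ≤ w.re) :
    w.re * Real.log w.re ≤ (w * Complex.log w).re + π / 2 * |w.im| := by
  have h0 : 0 < w.re := by linarith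
  have hlog : Real.log w.re ≤ Real.log ‖w‖ :=
    Real.log_le_log h0 ((le_abs_self _).trans (Complex.abs_re_le_norm w))
  have harg : |w.arg| ≤ π / 2 := Complex.abs_arg_le_pi_div_two_iff.2 h0.le
  have h1 : w.im * w.arg ≤ π / 2 * |w.im| := by
    calc w.im * w.arg ≤ |w.im| * |w.arg| := (le_abs_self _).trans (abs_mul _ _).le
      _ ≤ |w.im| * (π / 2) := by gcongr
      _ = π / 2 * |w.im| := mul_comm _ _
  have h2 := mul_le_mul_of_nonneg_left hlog h0.le
  rw [Complex.mul_re, Complex.log_re, Complex.log_im]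
  linarith

/-- Translating a function bounded below by `C` so that it is at least `1` changes
`|x| log⁺ |x|` in a controlled way. -/
lemma abs_mul_logPlus_abs_le {x C : ℝ} (hx : C ≤ x) :
    |x| * logPlus |x| ≤ (1 + |C - 1|) *
      (Real.log (1 + |C - 1|) * (x + (1 - C)) + (x + (1 - C)) * Real.log (x + (1 - C))) := by
  set A := 1 + |C - 1|
  set U := x + (1 - C) with hU
  have hA : 1 ≤ A := by simp [A]
  have hU1 : 1 ≤ U := by linarith
  have habs : |x| ≤ A * U := by
    calc |x| = |U + (C - 1)| := by congr 1; rw [hU]; ring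
      _ ≤ U + |C - 1| := (abs_add_le _ _).trans (by rw [abs_of_pos (by linarith)])
      _ ≤ A * U := by
        have := mul_le_mul_of_nonneg_left hU1 (abs_nonneg (C - 1))
        simp only [A]
        linarith
  have hAU : 0 ≤ Real.log (A * U) := Real.log_nonneg (by nlinarith)
  have hlog : logPlus |x| ≤ Real.log (A * U) := by
    refine max_le ?_ hAU
    rcases (abs_nonneg x).eq_or_lt with h0 | h0
    · rwa [← h0, Real.log_zero]
    · exact Real.log_le_log h0 habs
  calc |x| * logPlus |x| ≤ (A * U) * Real.log (A * U) :=
        mul_le_mul habs hlog (le_max_right _ _) (by positivity)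
    _ = A * (Real.log A * U + U * Real.log U) := by
        rw [Real.log_mul (by positivity) (by positivity)]
        ring

/-- A nonvanishing imaginary part on the disk has constant sign. -/
lemma exists_abs_im_eq_mul_im {h : ℂ → ℂ} (hh : ContinuousOn h unitDisk)
    (him : ∀ z ∈ unitDisk, (h z).im ≠ 0) :
    ∃ ε : ℝ, ∀ z ∈ unitDisk, |(h z).im| = ε * (h z).im := by
  have hpre : IsPreconnected unitDisk := (convex_ball (0 : ℂ) 1).isPreconnected
  rcases hpre.mapsTo_Ioi_or_Iio (Complex.continuous_im.comp_continuousOn hh) him with H | H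
  · exact ⟨1, fun z hz => by rw [one_mul]; exact abs_of_pos (H hz)⟩
  · exact ⟨-1, fun z hz => by rw [neg_one_mul]; exact abs_of_neg (H hz)⟩

/-- Partial converse of Zygmund's theorem (Theorem 1.2). -/
theorem zygmund_converse (h g f : ℂ → ℂ) (C : ℝ)
    (hh : DifferentiableOn ℂ h unitDisk) (hg : DifferentiableOn ℂ g unitDisk)
    (hg0 : g 0 = 0)
    (hf : ∀ z ∈ unitDisk, f z = h z + (starRingEnd ℂ) (g z))
    (hre : ∀ z ∈ unitDisk, C ≤ (f z).re)
    (him : ∀ z ∈ unitDisk, (h z).im ≠ 0)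
    (hf1 : InHardy 1 f) :
    InZygmundClass (fun z => (f z).re) := by
  obtain ⟨K, hK⟩ := hf1
  obtain ⟨ε, hε⟩ := exists_abs_im_eq_mul_im hh.continuousOn him
  set A : ℝ := 1 + |C - 1| with hA
  have hA0 : 0 < A := by positivity
  set G : ℂ → ℂ := fun z => h z + g z + ((1 - C : ℝ) : ℂ) with hG
  have hGre : ∀ z ∈ unitDisk, (G z).re = (f z).re + (1 - C) := fun z hz => by
    simp [hG, hf z hz]
  have hGre1 : ∀ z ∈ unitDisk, 1 ≤ (G z).re := fun z hz => by
    rw [hGre z hz]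
    linarith [hre z hz]
  have hGim : ∀ z ∈ unitDisk, |(G z).im| ≤ 2 * (ε * (h z).im) + ‖f z‖ := fun z hz => by
    have h1 : (G z).im = 2 * (h z).im - (f z).im := by
      simp [hG, hf z hz]
      ring
    rw [h1, ← hε z hz]
    refine (abs_sub _ _).trans ?_
    rw [abs_mul, abs_two]
    linarith [Complex.abs_im_le_norm (f z)]
  have hGd : DifferentiableOn ℂ G unitDisk := (hh.add hg).add_const _
  set Φ : ℂ → ℂ := fun z =>
    (A : ℂ) * ((Real.log A : ℂ) * G z + G z * Complex.log (G z) + ((π * ε : ℝ) : ℂ) * (-I * h z))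
    with hΦ
  have hΦd : DifferentiableOn ℂ Φ unitDisk := by
    have hlog : DifferentiableOn ℂ (fun z => Complex.log (G z)) unitDisk :=
      hGd.clog fun z hz => Or.inl (by linarith [hGre1 z hz])
    exact (((hGd.const_mul _).add (hGd.mul hlog)).add ((hh.const_mul _).const_mul _)).const_mul _
  have hpt : ∀ z ∈ unitDisk, |(f z).re| * logPlus |(f z).re| ≤
      (Φ z).re + A * (π / 2) * ‖f z‖ := fun z hz => by
    have h1 := abs_mul_logPlus_abs_le (hre z hz)
    rw [← hGre z hz, ← hA] at h1
    have h2 := re_mul_log_re_le (hGre1 z hz)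
    have h3 := mul_le_mul_of_nonneg_left (hGim z hz) (by positivity : 0 ≤ π / 2)
    have h4 : (Φ z).re = A * (Real.log A * (G z).re + (G z * Complex.log (G z)).re
        + π * ε * (h z).im) := by
      simp only [hΦ, Complex.re_ofReal_mul, Complex.add_re]
      simp
    rw [h4]
    refine h1.trans ?_
    calc _ ≤ A * (Real.log A * (G z).re + (G z * Complex.log (G z)).re
          + π * ε * (h z).im + π / 2 * ‖f z‖) := by
          refine mul_le_mul_of_nonneg_left ?_ hA0.le
          linarith
      _ = _ := by ring
  refine ⟨2 * π * ((Φ 0).re + A * (π / 2) * K), fun r hr0 hr1 => ?_⟩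
  have hsub : Metric.sphere (0 : ℂ) r ⊆ unitDisk :=
    Metric.sphere_subset_closedBall.trans (Metric.closedBall_subset_ball hr1)
  have hfc : ContinuousOn f unitDisk :=
    (hh.continuousOn.add (Complex.continuous_conj.comp_continuousOn hg.continuousOn)).congr hf
  have hu : CircleIntegrable (fun z => |(f z).re| * logPlus |(f z).re|) 0 r :=
    ((continuous_abs_mul_logPlus_abs.comp Complex.continuous_re).comp_continuousOn
      (hfc.mono hsub)).circleIntegrable hr0.le
  have hΦi : CircleIntegrable (fun z => (Φ z).re) 0 r :=
    (Complex.continuous_re.comp_continuousOn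
      (hΦd.continuousOn.mono hsub)).circleIntegrable hr0.le
  have hfi : CircleIntegrable (fun z => A * (π / 2) * ‖f z‖) 0 r :=
    (continuousOn_const.mul (hfc.mono hsub).norm).circleIntegrable hr0.le
  rw [zygmundIntegral_eq_circleAverage]
  gcongr
  calc _ ≤ circleAverage (fun z => (Φ z).re + A * (π / 2) * ‖f z‖) 0 r :=
        circleAverage_mono hu (hΦi.add hfi) fun z hz =>
          hpt z (hsub (by rwa [abs_of_pos hr0] at hz))
    _ = (Φ 0).re + A * (π / 2) * circleMean 1 f r := by
        rw [circleAverage_fun_add hΦi hfi, circleAverage_re_of_differentiableOn hΦd hr0 hr1,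
          circleMean_one_eq_circleAverage]
        exact congrArg _ (circleAverage_fun_smul (a := A * (π / 2)) (f := fun z => ‖f z‖))
    _ ≤ (Φ 0).re + A * (π / 2) * K := by
        gcongr
        exact hK r hr0 hr1
end
end

section
/- Let f = h + conj(g) be a harmonic function in the unit disk 𝔻 with Taylor expansions h(z) = Σ_{n≥0} a_n zⁿ and g(z) = Σ_{n≥0} b_n zⁿ (where b₀ = 0). If f ∈ h^p for some p ∈ (1,2], then Σ_{n≥0} (n+1)^{p−2} (|a_n|^p + |b_n|^p) < ∞. -/
open Complex Real Set

noncomputable section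

section Paley

open MeasureTheory AddCircle

lemma sum_inv_sq_filter_lt_le (s : Finset ℕ) {t : ℝ} (ht : 0 < t) :
    ∑ n ∈ s.filter (fun n : ℕ => t < (n : ℝ) + 1), (((n : ℝ) + 1) ^ 2)⁻¹ ≤ 2 / t := by
  have hsub : (s.filter fun n : ℕ => t < (n : ℝ) + 1).image Nat.succ ⊆
      Finset.Ioo ⌊t⌋₊ (s.sup id + 2) := by
    intro m hm
    simp only [Finset.mem_image, Finset.mem_filter] at hm
    obtain ⟨n, ⟨hn, htn⟩, rfl⟩ := hm
    have h1 : n ≤ s.sup id := Finset.le_sup (f := id) hn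
    have h2 : ⌊t⌋₊ < n + 1 := (Nat.floor_lt ht.le).2 (by exact_mod_cast htn)
    simp only [Finset.mem_Ioo, Nat.succ_eq_add_one]
    omega
  calc ∑ n ∈ s.filter (fun n : ℕ => t < (n : ℝ) + 1), (((n : ℝ) + 1) ^ 2)⁻¹
      = ∑ m ∈ (s.filter fun n : ℕ => t < (n : ℝ) + 1).image Nat.succ, ((m : ℝ) ^ 2)⁻¹ := by
        rw [Finset.sum_image (Nat.succ_injective.injOn)]
        simp
    _ ≤ ∑ m ∈ Finset.Ioo ⌊t⌋₊ (s.sup id + 2), ((m : ℝ) ^ 2)⁻¹ :=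
        Finset.sum_le_sum_of_subset_of_nonneg hsub fun _ _ _ => by positivity
    _ ≤ 2 / ((⌊t⌋₊ : ℝ) + 1) := sum_Ioo_inv_sq_le _ _
    _ ≤ 2 / t := by
        gcongr
        exact (Nat.lt_floor_add_one t).le

lemma lintegral_Ioo_zero_rpow {q u : ℝ} (hq : -1 < q) (hu : 0 ≤ u) :
    ∫⁻ x in Ioo 0 u, ENNReal.ofReal (x ^ q) = ENNReal.ofReal (u ^ (q + 1) / (q + 1)) := by
  have hi : IntegrableOn (fun x : ℝ => x ^ q) (Ioo 0 u) :=
    ((intervalIntegral.intervalIntegrable_rpow' hq (a := 0) (b := u)).1).mono_set Ioo_subset_Ioc_self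
  rw [← ofReal_integral_eq_lintegral_ofReal hi, ← integral_Ioc_eq_integral_Ioo,
    ← intervalIntegral.integral_of_le hu, integral_rpow (Or.inl hq),
    Real.zero_rpow (by linarith), sub_zero]
  exact (ae_restrict_mem measurableSet_Ioo).mono fun x hx => Real.rpow_nonneg hx.1.le _

lemma lintegral_Ioi_rpow {q u : ℝ} (hq : q < -1) (hu : 0 < u) :
    ∫⁻ x in Ioi u, ENNReal.ofReal (x ^ q) = ENNReal.ofReal (-u ^ (q + 1) / (q + 1)) := by
  rw [← ofReal_integral_eq_lintegral_ofReal (integrableOn_Ioi_rpow_of_lt hq hu),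
    integral_Ioi_rpow_of_lt hq hu]
  exact (ae_restrict_mem measurableSet_Ioi).mono fun x hx =>
    Real.rpow_nonneg (hu.le.trans (le_of_lt hx)) _

variable {T : ℝ} [Fact (0 < T)]

lemma norm_fourierCoeff_le (F : AddCircle T → ℂ) (n : ℤ) :
    ‖fourierCoeff F n‖ ≤ ∫ x, ‖F x‖ ∂haarAddCircle := by
  refine (norm_integral_le_integral_norm _).trans_eq (integral_congr_ae (.of_forall fun x => ?_))
  simp only [norm_smul, fourier_apply, Circle.norm_coe, one_mul]

lemma sum_sq_fourierCoeff_le {F : AddCircle T → ℂ} (hF : MemLp F 2 haarAddCircle) {k : ℕ → ℤ}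
    (hk : k.Injective) (s : Finset ℕ) :
    ∑ n ∈ s, ‖fourierCoeff F (k n)‖ ^ 2 ≤ ∫ x, ‖F x‖ ^ 2 ∂haarAddCircle := by
  have h := hasSum_sq_fourierCoeff hF.toLp
  have he : ∫ x, ‖hF.toLp F x‖ ^ 2 ∂haarAddCircle = ∫ x, ‖F x‖ ^ 2 ∂haarAddCircle :=
    integral_congr_ae (hF.coeFn_toLp.mono fun x hx => by simp only [hx])
  simp only [fourierCoeff_congr_ae hF.coeFn_toLp, he] at h
  have := sum_le_hasSum (s.map ⟨k, hk⟩) (fun _ _ => by positivity) h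
  rwa [Finset.sum_map] at this

/-- The weak-type estimate behind Paley's inequality. -/
lemma sum_inv_sq_filter_fourierCoeff_le (F : C(AddCircle T, ℂ)) {k : ℕ → ℤ}
    (hk : k.Injective) (s : Finset ℕ) {t : ℝ} (ht : 0 < t) :
    ∑ n ∈ s.filter (fun n : ℕ => t < ((n : ℝ) + 1) * ‖fourierCoeff F (k n)‖),
        (((n : ℝ) + 1) ^ 2)⁻¹ ≤
      4 / t * ∫ x in {x | t < ‖F x‖}, ‖F x‖ ∂haarAddCircle +
        4 / t ^ 2 * ∫ x in {x | t < ‖F x‖}ᶜ, ‖F x‖ ^ 2 ∂haarAddCircle := by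
  set A : Set (AddCircle T) := {x | t < ‖F x‖}
  have hA : MeasurableSet A := measurableSet_lt measurable_const F.continuous.norm.measurable
  set I := ∫ x in A, ‖F x‖ ∂haarAddCircle with hI
  set J := ∫ x in Aᶜ, ‖F x‖ ^ 2 ∂haarAddCircle with hJ
  have hF2 : MemLp F 2 haarAddCircle :=
    F.continuous.memLp_of_hasCompactSupport (HasCompactSupport.of_compactSpace F)
  have hFi : Integrable F haarAddCircle := hF2.integrable one_le_two
  have hI0 : 0 ≤ I := integral_nonneg fun _ => norm_nonneg _
  have hIn : ∫ x, ‖A.indicator F x‖ ∂haarAddCircle = I := by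
    simp only [norm_indicator_eq_indicator_norm, hI, integral_indicator hA]
  have hJn : ∫ x, ‖Aᶜ.indicator F x‖ ^ 2 ∂haarAddCircle = J := by
    rw [hJ, ← integral_indicator hA.compl]
    congr 1 with x
    by_cases hx : x ∈ Aᶜ <;> simp [hx]
  have hadd (n : ℤ) : fourierCoeff F n =
      fourierCoeff (A.indicator F) n + fourierCoeff (Aᶜ.indicator F) n := by
    rw [← Pi.add_apply, ← fourierCoeff.add (hFi.indicator hA) (hFi.indicator hA.compl),
      indicator_self_add_compl]
  have hsplit : s.filter (fun n : ℕ => t < ((n : ℝ) + 1) * ‖fourierCoeff F (k n)‖) ⊆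
      s.filter (fun n : ℕ => t < 2 * I * ((n : ℝ) + 1)) ∪
      s.filter (fun n : ℕ => t < 2 * (((n : ℝ) + 1) * ‖fourierCoeff (Aᶜ.indicator F) (k n)‖)) := by
    intro n hn
    simp only [Finset.mem_filter, Finset.mem_union] at hn ⊢
    by_contra! hc
    have h1 := hc.1 hn.1
    have h2 := hc.2 hn.1
    have h3 := norm_fourierCoeff_le (A.indicator F) (k n)
    rw [hIn] at h3
    have h4 := norm_add_le (fourierCoeff (A.indicator F) (k n))
      (fourierCoeff (Aᶜ.indicator F) (k n))
    rw [← hadd] at h4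
    have h5 := mul_le_mul_of_nonneg_left (h4.trans (add_le_add_left h3 _))
      (by positivity : (0 : ℝ) ≤ n + 1)
    nlinarith [hn.2]
  have hlow : ∑ n ∈ s.filter (fun n : ℕ => t < 2 * I * ((n : ℝ) + 1)),
      (((n : ℝ) + 1) ^ 2)⁻¹ ≤ 4 / t * I := by
    rcases hI0.eq_or_lt with h0 | h0
    · simp [← h0, ht.le, not_lt.2]
    · have h := sum_inv_sq_filter_lt_le s (t := t / (2 * I)) (by positivity)
      simp only [div_lt_iff₀' (by positivity : 0 < 2 * I)] at h
      refine h.trans_eq ?_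
      field_simp
      norm_num
  have hhigh : ∑ n ∈ s.filter (fun n : ℕ =>
        t < 2 * (((n : ℝ) + 1) * ‖fourierCoeff (Aᶜ.indicator F) (k n)‖)),
      (((n : ℝ) + 1) ^ 2)⁻¹ ≤ 4 / t ^ 2 * J := by
    calc _ ≤ ∑ n ∈ s.filter (fun n : ℕ =>
        t < 2 * (((n : ℝ) + 1) * ‖fourierCoeff (Aᶜ.indicator F) (k n)‖)),
          4 / t ^ 2 * ‖fourierCoeff (Aᶜ.indicator F) (k n)‖ ^ 2 := by
          refine Finset.sum_le_sum fun n hn => ?_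
          have h := (Finset.mem_filter.1 hn).2
          rw [inv_le_iff_one_le_mul₀ (by positivity), div_mul_eq_mul_div, div_mul_eq_mul_div,
            one_le_div (by positivity)]
          calc t ^ 2 ≤ (2 * (((n : ℝ) + 1) * ‖fourierCoeff (Aᶜ.indicator F) (k n)‖)) ^ 2 := by
                gcongr
            _ = _ := by ring
      _ ≤ ∑ n ∈ s, 4 / t ^ 2 * ‖fourierCoeff (Aᶜ.indicator F) (k n)‖ ^ 2 :=
          Finset.sum_le_sum_of_subset_of_nonneg (Finset.filter_subset _ _)
            fun _ _ _ => by positivity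
      _ ≤ 4 / t ^ 2 * J := by
          rw [← Finset.mul_sum, ← hJn]
          gcongr
          exact sum_sq_fourierCoeff_le (hF2.indicator hA.compl) hk s
  refine (Finset.sum_le_sum_of_subset_of_nonneg hsplit fun _ _ _ => by positivity).trans
    (le_trans ?_ (add_le_add hlow hhigh))
  rw [← Finset.sum_union_inter]
  exact le_add_of_nonneg_right (Finset.sum_nonneg fun _ _ => by positivity)

/-- The kernel produced by splitting a function of size `v` at height `x`: the large part is
measured in `L¹`, the small part in `L²`. -/
def marcinkiewiczKernel (p x v : ℝ) : ℝ :=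
  if x < v then x ^ (p - 2) * v else x ^ (p - 3) * v ^ 2

lemma marcinkiewiczKernel_nonneg (p : ℝ) {x v : ℝ} (hx : 0 ≤ x) (hv : 0 ≤ v) :
    0 ≤ marcinkiewiczKernel p x v := by
  unfold marcinkiewiczKernel
  split_ifs <;> positivity

lemma measurable_marcinkiewiczKernel (p : ℝ) :
    Measurable fun z : ℝ × ℝ => marcinkiewiczKernel p z.1 z.2 :=
  Measurable.ite (measurableSet_lt measurable_fst measurable_snd) (by fun_prop) (by fun_prop)

lemma lintegral_marcinkiewiczKernel_le {p v : ℝ} (hp1 : 1 < p) (hp2 : p < 2) (hv : 0 ≤ v) :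
    ∫⁻ x in Ioi 0, ENNReal.ofReal (marcinkiewiczKernel p x v) ≤
      ENNReal.ofReal ((1 / (p - 1) + 1 / (2 - p)) * v ^ p) := by
  have hp1' : 0 < p - 1 := by linarith
  have hp2' : 0 < 2 - p := by linarith
  rcases hv.eq_or_lt with rfl | hv
  · rw [setLIntegral_congr_fun (g := fun _ => 0) measurableSet_Ioi]
    · simp
    · intro x hx
      simp [marcinkiewiczKernel, not_lt.2 (le_of_lt (mem_Ioi.1 hx))]
  have h1 : ∫⁻ x in Ioo 0 v, ENNReal.ofReal (marcinkiewiczKernel p x v) =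
      ENNReal.ofReal (1 / (p - 1) * v ^ p) := by
    rw [setLIntegral_congr_fun (g := fun x => ENNReal.ofReal v * ENNReal.ofReal (x ^ (p - 2)))
      measurableSet_Ioo, lintegral_const_mul _ (by fun_prop),
      lintegral_Ioo_zero_rpow (by linarith) hv.le, ← ENNReal.ofReal_mul hv.le]
    · have : v ^ p = v ^ (p - 1) * v := by rw [← Real.rpow_add_one hv.ne', sub_add_cancel]
      rw [this, show p - 2 + 1 = p - 1 by ring]
      ring_nf
    · intro x hx
      simp only [marcinkiewiczKernel, if_pos hx.2]
      rw [mul_comm, ENNReal.ofReal_mul hv.le]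
  have h2 : ∫⁻ x in Ici v, ENNReal.ofReal (marcinkiewiczKernel p x v) =
      ENNReal.ofReal (1 / (2 - p) * v ^ p) := by
    rw [setLIntegral_congr_fun
      (g := fun x => ENNReal.ofReal (v ^ 2) * ENNReal.ofReal (x ^ (p - 3)))
      measurableSet_Ici, lintegral_const_mul _ (by fun_prop),
      setLIntegral_congr Ioi_ae_eq_Ici.symm,
      lintegral_Ioi_rpow (by linarith) hv, ← ENNReal.ofReal_mul (by positivity)]
    · congr 1
      have : v ^ p = v ^ (p - 2) * v ^ 2 := by
        rw [← Real.rpow_natCast v 2, ← Real.rpow_add hv]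
        norm_num
      rw [this, show p - 3 + 1 = -(2 - p) by ring, neg_div_neg_eq, neg_sub]
      ring
    · intro x hx
      simp only [marcinkiewiczKernel, if_neg (not_lt.2 (mem_Ici.1 hx))]
      rw [mul_comm, ENNReal.ofReal_mul (by positivity)]
  rw [← Ioo_union_Ici_eq_Ioi hv, add_mul, ENNReal.ofReal_add (by positivity) (by positivity),
    ← h1, ← h2]
  exact lintegral_union_le _ _ _

lemma sum_filter_fourierCoeff_le_integral_kernel (p : ℝ) (F : C(AddCircle T, ℂ)) {k : ℕ → ℤ}
    (hk : k.Injective) (s : Finset ℕ) {t : ℝ} (ht : 0 < t) :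
    ENNReal.ofReal (t ^ (p - 1) *
      ∑ n ∈ s.filter (fun n : ℕ => t < ((n : ℝ) + 1) * ‖fourierCoeff F (k n)‖),
        (((n : ℝ) + 1) ^ 2)⁻¹) ≤
      4 * ∫⁻ x, ENNReal.ofReal (marcinkiewiczKernel p t ‖F x‖) ∂haarAddCircle := by
  have hA : MeasurableSet {x | t < ‖F x‖} :=
    measurableSet_lt measurable_const F.continuous.norm.measurable
  have hi1 : Integrable (fun x => t ^ (p - 2) * ‖F x‖) haarAddCircle :=
    Continuous.integrable_of_hasCompactSupport (by fun_prop) (HasCompactSupport.of_compactSpace _)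
  have hi2 : Integrable (fun x => t ^ (p - 3) * ‖F x‖ ^ 2) haarAddCircle :=
    Continuous.integrable_of_hasCompactSupport (by fun_prop) (HasCompactSupport.of_compactSpace _)
  classical
  have hker : (fun x => marcinkiewiczKernel p t ‖F x‖) = {x | t < ‖F x‖}.piecewise
      (fun x => t ^ (p - 2) * ‖F x‖) (fun x => t ^ (p - 3) * ‖F x‖ ^ 2) := by
    ext x
    simp [marcinkiewiczKernel, Set.piecewise]
  have hint := integral_piecewise hA hi1.integrableOn hi2.integrableOn
  have hpi := Integrable.piecewise hA hi1.integrableOn hi2.integrableOn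
  rw [← hker] at hint hpi
  rw [← ofReal_integral_eq_lintegral_ofReal hpi
    (.of_forall fun x => marcinkiewiczKernel_nonneg p ht.le (norm_nonneg _)), hint,
    integral_const_mul, integral_const_mul, ← ENNReal.ofReal_ofNat 4,
    ← ENNReal.ofReal_mul (by norm_num)]
  refine ENNReal.ofReal_le_ofReal ((mul_le_mul_of_nonneg_left
    (sum_inv_sq_filter_fourierCoeff_le F hk s ht) (by positivity)).trans_eq ?_)
  rw [show p - 1 = p - 3 + 1 + 1 by ring, show p - 2 = p - 3 + 1 by ring,
    Real.rpow_add_one ht.ne', Real.rpow_add_one ht.ne']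
  field_simp

lemma paley_of_lt_two {p : ℝ} (hp1 : 1 < p) (hp2 : p < 2) (F : C(AddCircle T, ℂ)) {k : ℕ → ℤ}
    (hk : k.Injective) (s : Finset ℕ) :
    ∑ n ∈ s, ((n : ℝ) + 1) ^ (p - 2) * ‖fourierCoeff F (k n)‖ ^ p ≤
      4 * p * (1 / (p - 1) + 1 / (2 - p)) * ∫ x, ‖F x‖ ^ p ∂haarAddCircle := by
  have hp0 : 0 < p := by linarith
  have hp1' : 0 < p - 1 := by linarith
  have hp2' : 0 < 2 - p := by linarith
  set u : ℕ → ℝ := fun n => ((n : ℝ) + 1) * ‖fourierCoeff F (k n)‖ with hu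
  have hu0 (n : ℕ) : 0 ≤ u n := by positivity
  have hFp : Integrable (fun x => ‖F x‖ ^ p) haarAddCircle :=
    Continuous.integrable_of_hasCompactSupport
      (F.continuous.norm.rpow_const fun _ => Or.inr hp0.le) (HasCompactSupport.of_compactSpace _)
  have hterm (n : ℕ) : ENNReal.ofReal (((n : ℝ) + 1) ^ (p - 2) * ‖fourierCoeff F (k n)‖ ^ p) =
      ∫⁻ t in Ioi 0, ENNReal.ofReal p *
        (Iio (u n)).indicator (fun t => ENNReal.ofReal (t ^ (p - 1) * (((n : ℝ) + 1) ^ 2)⁻¹)) t := by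
    rw [lintegral_const_mul _ (Measurable.indicator (by fun_prop) measurableSet_Iio),
      lintegral_indicator measurableSet_Iio, Measure.restrict_restrict measurableSet_Iio,
      inter_comm, Ioi_inter_Iio]
    simp_rw [ENNReal.ofReal_mul' (inv_nonneg.2 (sq_nonneg ((n : ℝ) + 1)))]
    rw [lintegral_mul_const _ (by fun_prop), lintegral_Ioo_zero_rpow (by linarith) (hu0 n),
      ← ENNReal.ofReal_mul' (by positivity), ← ENNReal.ofReal_mul hp0.le]
    congr 1
    have : (0 : ℝ) < n + 1 := by positivity
    rw [hu, Real.mul_rpow this.le (norm_nonneg _), sub_add_cancel, Real.rpow_sub this,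
      Real.rpow_two]
    field_simp
  have key : ENNReal.ofReal (∑ n ∈ s, ((n : ℝ) + 1) ^ (p - 2) * ‖fourierCoeff F (k n)‖ ^ p) ≤
      ENNReal.ofReal (4 * p * (1 / (p - 1) + 1 / (2 - p)) * ∫ x, ‖F x‖ ^ p ∂haarAddCircle) := by
    calc _ = ∫⁻ t in Ioi 0, ∑ n ∈ s, ENNReal.ofReal p *
          (Iio (u n)).indicator
            (fun t => ENNReal.ofReal (t ^ (p - 1) * (((n : ℝ) + 1) ^ 2)⁻¹)) t := by
          rw [ENNReal.ofReal_sum_of_nonneg fun _ _ => by positivity, lintegral_finsetSum]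
          · exact Finset.sum_congr rfl fun n _ => hterm n
          · exact fun n _ => (Measurable.indicator (by fun_prop) measurableSet_Iio).const_mul _
      _ ≤ ∫⁻ t in Ioi 0, ENNReal.ofReal p *
          (4 * ∫⁻ x, ENNReal.ofReal (marcinkiewiczKernel p t ‖F x‖) ∂haarAddCircle) := by
          refine setLIntegral_mono' measurableSet_Ioi fun t (ht : 0 < t) => ?_
          rw [← Finset.mul_sum]
          refine mul_le_mul_right (le_trans (le_of_eq ?_)
            (sum_filter_fourierCoeff_le_integral_kernel p F hk s ht)) _
          rw [Finset.mul_sum, ENNReal.ofReal_sum_of_nonneg fun _ _ => by positivity,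
            Finset.sum_filter]
          rfl
      _ = ENNReal.ofReal (4 * p) * ∫⁻ x, (∫⁻ t in Ioi 0,
          ENNReal.ofReal (marcinkiewiczKernel p t ‖F x‖)) ∂haarAddCircle := by
          have hm : Measurable fun z : ℝ × AddCircle T =>
              ENNReal.ofReal (marcinkiewiczKernel p z.1 ‖F z.2‖) :=
            ((measurable_marcinkiewiczKernel p).comp (measurable_fst.prodMk
              (F.continuous.norm.measurable.comp measurable_snd))).ennreal_ofReal
          rw [lintegral_const_mul _ (hm.lintegral_prod_right'.const_mul _),
            lintegral_const_mul _ hm.lintegral_prod_right', lintegral_lintegral_swap hm.aemeasurable,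
            ENNReal.ofReal_mul (by norm_num), ENNReal.ofReal_ofNat]
          ring
      _ ≤ ENNReal.ofReal (4 * p) * ∫⁻ x,
          ENNReal.ofReal ((1 / (p - 1) + 1 / (2 - p)) * ‖F x‖ ^ p) ∂haarAddCircle := by
          gcongr with x
          exact lintegral_marcinkiewiczKernel_le hp1 hp2 (norm_nonneg _)
      _ = _ := by
          rw [← ofReal_integral_eq_lintegral_ofReal (hFp.const_mul _)
            (.of_forall fun x => by positivity), integral_const_mul,
            ← ENNReal.ofReal_mul (by positivity), mul_assoc (4 * p)]
  refine (ENNReal.ofReal_le_ofReal_iff ?_).1 key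
  exact mul_nonneg (by positivity) (integral_nonneg fun _ => by positivity)

/-- Paley's inequality for the Fourier coefficients of a continuous function. -/
theorem exists_paley_const {p : ℝ} (hp1 : 1 < p) (hp2 : p ≤ 2) :
    ∃ C : ℝ, 0 ≤ C ∧ ∀ (F : C(AddCircle T, ℂ)) (k : ℕ → ℤ), k.Injective → ∀ s : Finset ℕ,
      ∑ n ∈ s, ((n : ℝ) + 1) ^ (p - 2) * ‖fourierCoeff F (k n)‖ ^ p ≤
        C * ∫ x, ‖F x‖ ^ p ∂haarAddCircle := by
  rcases hp2.lt_or_eq with hp2 | rfl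
  · have hp1' : 0 < p - 1 := by linarith
    have hp2' : 0 < 2 - p := by linarith
    exact ⟨4 * p * (1 / (p - 1) + 1 / (2 - p)), by positivity,
      fun F k hk s => paley_of_lt_two hp1 hp2 F hk s⟩
  · refine ⟨1, zero_le_one, fun F k hk s => ?_⟩
    simpa using sum_sq_fourierCoeff_le
      (F.continuous.memLp_of_hasCompactSupport (HasCompactSupport.of_compactSpace F)) hk s

lemma fourierCoeff_eq_of_hasSum {ι : Type*} [Countable ι] {A : ι → ℂ} (hA : Summable A)
    {k : ι → ℤ} {H : AddCircle T → ℂ} (hH : ∀ t, HasSum (fun i => A i * fourier (k i) t) (H t))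
    (j : ι) (hj : ∀ i, i ≠ j → k i = k j → A i = 0) :
    fourierCoeff H (k j) = A j := by
  have hnorm (i : ι) : ∫ t, ‖fourier (-k j) t • (A i * fourier (k i) t)‖
      ∂(haarAddCircle : Measure (AddCircle T)) = ‖A i‖ := by
    simp only [norm_smul, norm_mul, fourier_apply, Circle.norm_coe, one_mul, mul_one]
    simp
  have hsum := hasSum_integral_of_summable_integral_norm
    (μ := (haarAddCircle : Measure (AddCircle T)))
    (F := fun i t => fourier (-k j) t • (A i * fourier (k i) t)) (fun i =>
      Continuous.integrable_of_hasCompactSupport (by fun_prop) (HasCompactSupport.of_compactSpace _))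
    (by simpa only [hnorm] using hA.norm)
  have hint (i : ι) : ∫ t, fourier (-k j) t • (A i * fourier (k i) t)
      ∂(haarAddCircle : Measure (AddCircle T)) = A i * (Pi.single (k i) 1 : ℤ → ℂ) (k j) := by
    rw [← fourierCoeff_fourier (T := T)]
    exact fourierCoeff.const_mul _ _ _
  have hH' : ∫ t, ∑' i, fourier (-k j) t • (A i * fourier (k i) t)
      ∂(haarAddCircle : Measure (AddCircle T)) = fourierCoeff H (k j) :=
    integral_congr_ae (.of_forall fun t => ((hH t).const_smul (fourier (-k j) t)).tsum_eq)
  simp only [hint, hH'] at hsum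
  refine hsum.unique ?_
  convert hasSum_single j fun i hi => ?_ using 1
  · simp
  · by_cases hk : k i = k j
    · simp [hj i hi hk]
    · simp [Pi.single_eq_of_ne (Ne.symm hk)]

/-- The Fourier coefficients of `t ↦ f (r e^{it})` dominate the dilated Taylor coefficients. -/
lemma norm_coeff_le_norm_fourierCoeff {h g f : ℂ → ℂ} {a b : ℕ → ℂ} (hb0 : b 0 = 0)
    (hha : ∀ z ∈ unitDisk, HasSum (fun n : ℕ => a n * z ^ n) (h z))
    (hgb : ∀ z ∈ unitDisk, HasSum (fun n : ℕ => b n * z ^ n) (g z))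
    (hf : ∀ z ∈ unitDisk, f z = h z + (starRingEnd ℂ) (g z))
    {r : ℝ} (hr0 : 0 < r) (hr1 : r < 1) (n : ℕ) :
    ‖a n‖ * r ^ n ≤ ‖fourierCoeff (fun t : AddCircle T => f (r * toCircle t)) n‖ ∧
      ‖b n‖ * r ^ n ≤ ‖fourierCoeff (fun t : AddCircle T => f (r * toCircle t)) (-n)‖ := by
  have hmem (z : Circle) : (r * z : ℂ) ∈ unitDisk := by
    simpa [unitDisk, abs_of_pos hr0, Circle.norm_coe] using hr1
  have hr : (r : ℂ) ∈ unitDisk := by simpa using hmem 1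
  set A : ℕ ⊕ ℕ → ℂ := Sum.elim (fun n => a n * r ^ n) (fun n => starRingEnd ℂ (b n) * r ^ n)
  set k : ℕ ⊕ ℕ → ℤ := Sum.elim (fun n => n) (fun n => -n)
  have hA : Summable A := by
    refine Summable.sum A (hha r hr).summable ?_
    have := (((hgb r hr).map (starRingEnd ℂ) continuous_conj).summable)
    simpa [Function.comp_def, A] using this
  have hH (t : AddCircle T) : HasSum (fun i => A i * fourier (k i) t) (f (r * toCircle t)) := by
    rw [hf _ (hmem _)]
    refine HasSum.sum ?_ ?_
    · convert hha _ (hmem (toCircle t)) using 2 with n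
      simp [A, k, toCircle_nsmul, mul_pow, mul_assoc]
    · convert (hgb _ (hmem (toCircle t))).map (starRingEnd ℂ) continuous_conj using 1
      ext n
      simp [A, k, toCircle_neg, toCircle_nsmul, mul_pow, mul_assoc, ← inv_pow,
        ← Circle.coe_inv_eq_conj]
  constructor
  · have := fourierCoeff_eq_of_hasSum hA hH (.inl n) (by
      rintro (m | m) hm hk
      · simp_all [k]
      · have : m = 0 := by simp [k] at hk; omega
        simp [A, this, hb0])
    simp only [k, A, Sum.elim_inl] at this
    rw [this]
    simp [abs_of_pos hr0]
  · rcases eq_or_ne n 0 with rfl | hn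
    · simp [hb0]
    have := fourierCoeff_eq_of_hasSum hA hH (.inr n) (by
      rintro (m | m) hm hk
      · simp [k] at hk; omega
      · simp_all [k])
    simp only [k, A, Sum.elim_inr] at this
    rw [this]
    simp [abs_of_pos hr0]

lemma integral_rpow_circle_le {p M : ℝ} (hp : 0 < p) {f : ℂ → ℂ} {r : ℝ}
    [Fact (0 < 2 * π)] (hM : circleMean p f r ≤ M) :
    ∫ t : AddCircle (2 * π), ‖f (r * toCircle t)‖ ^ p ∂haarAddCircle ≤ M ^ p := by
  set X := ∫ t : AddCircle (2 * π), ‖f (r * toCircle t)‖ ^ p ∂haarAddCircle with hX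
  have hX0 : 0 ≤ X := integral_nonneg fun _ => by positivity
  have hmean : circleMean p f r = X ^ (1 / p) := by
    rw [hX, integral_haarAddCircle, ← AddCircle.intervalIntegral_preimage (2 * π) 0, circleMean]
    simp [toCircle_apply_mk, Circle.coe_exp, Real.two_pi_pos.ne']
  rw [hmean] at hM
  calc X = (X ^ (1 / p)) ^ p := by
        rw [← Real.rpow_mul hX0, one_div_mul_cancel hp.ne', Real.rpow_one]
    _ ≤ M ^ p := by gcongr

end Paley

/-- Theorem 3.1 (i), first part: coefficients of a harmonic `h^p` function, `1 < p ≤ 2`. -/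
theorem coeff_hp (p : ℝ) (hp1 : 1 < p) (hp2 : p ≤ 2)
    (h g f : ℂ → ℂ) (a b : ℕ → ℂ)
    (hh : DifferentiableOn ℂ h unitDisk) (hg : DifferentiableOn ℂ g unitDisk)
    (hb0 : b 0 = 0)
    (hha : ∀ z ∈ unitDisk, HasSum (fun n : ℕ => a n * z ^ n) (h z))
    (hgb : ∀ z ∈ unitDisk, HasSum (fun n : ℕ => b n * z ^ n) (g z))
    (hf : ∀ z ∈ unitDisk, f z = h z + (starRingEnd ℂ) (g z))
    (hfp : InHardy p f) :
    Summable (fun n : ℕ => ((n : ℝ) + 1) ^ (p - 2) * (‖a n‖ ^ p + ‖b n‖ ^ p)) := by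
  have : Fact (0 < 2 * π) := ⟨Real.two_pi_pos⟩
  have hp0 : 0 < p := by linarith
  obtain ⟨C, hC0, hC⟩ := exists_paley_const (T := 2 * π) hp1 hp2
  obtain ⟨M, hM⟩ := hfp
  have hfc : ContinuousOn f unitDisk :=
    (hh.continuousOn.add (continuous_conj.comp_continuousOn hg.continuousOn)).congr hf
  refine summable_of_sum_le (c := 2 * (C * M ^ p)) (fun n => by positivity) fun s => ?_
  have hlim : Filter.Tendsto (fun r : ℝ => ∑ n ∈ s, ((n : ℝ) + 1) ^ (p - 2) *
      ((‖a n‖ * r ^ n) ^ p + (‖b n‖ * r ^ n) ^ p)) (nhdsWithin 1 (Iio 1))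
      (nhds (∑ n ∈ s, ((n : ℝ) + 1) ^ (p - 2) * (‖a n‖ ^ p + ‖b n‖ ^ p))) := by
    have hc : Continuous fun r : ℝ => ∑ n ∈ s, ((n : ℝ) + 1) ^ (p - 2) *
        ((‖a n‖ * r ^ n) ^ p + (‖b n‖ * r ^ n) ^ p) := by
      refine continuous_finsetSum _ fun n _ => continuous_const.mul (.add ?_ ?_) <;>
      exact Continuous.rpow_const (by fun_prop) fun _ => Or.inr hp0.le
    simpa using (hc.tendsto 1).mono_left nhdsWithin_le_nhds
  refine le_of_tendsto hlim ?_
  filter_upwards [Ioo_mem_nhdsLT (zero_lt_one' ℝ)] with r hr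
  have hmem (t : AddCircle (2 * π)) : (r * AddCircle.toCircle t : ℂ) ∈ unitDisk := by
    simpa [unitDisk, abs_of_pos hr.1, Circle.norm_coe] using hr.2
  have hFc : Continuous fun t : AddCircle (2 * π) => f (r * AddCircle.toCircle t) :=
    hfc.comp_continuous
      (continuous_const.mul (continuous_subtype_val.comp AddCircle.continuous_toCircle)) hmem
  let F : C(AddCircle (2 * π), ℂ) := ⟨_, hFc⟩
  have hF := mul_le_mul_of_nonneg_left (integral_rpow_circle_le hp0 (hM r hr.1 hr.2)) hC0
  have hcoeff := norm_coeff_le_norm_fourierCoeff (T := 2 * π) hb0 hha hgb hf hr.1 hr.2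
  have hbound (k : ℕ → ℤ) (hk : k.Injective) (c : ℕ → ℂ)
      (hc : ∀ n, ‖c n‖ * r ^ n ≤ ‖fourierCoeff F (k n)‖) :
      ∑ n ∈ s, ((n : ℝ) + 1) ^ (p - 2) * (‖c n‖ * r ^ n) ^ p ≤ C * M ^ p := by
    refine (Finset.sum_le_sum fun n _ => ?_).trans ((hC F k hk s).trans hF)
    have := hr.1
    gcongr
    exact hc n
  simp only [mul_add, Finset.sum_add_distrib, two_mul]
  exact add_le_add (hbound _ Nat.cast_injective a fun n => (hcoeff n).1)
    (hbound _ (neg_injective.comp Nat.cast_injective) b fun n => (hcoeff n).2)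
end
end

section
/- Let f = h + conj(g) be a harmonic function in the unit disk 𝔻 (h, g analytic in 𝔻, g(0)=0). If f ∈ h^p for some p with 1 < p < ∞, then both h and g belong to the Hardy space H^p. -/
open Complex Real Set

noncomputable section

/-- Real continuous functions on the circle are uniformly approximated by real parts of entire
functions. -/
theorem exists_entire_re_approx (φ : C(AddCircle (2 * π), ℝ)) {δ : ℝ} (hδ : 0 < δ) :
    ∃ G : ℂ → ℂ, Differentiable ℂ G ∧ (G 0).im = 0 ∧
      ∀ θ : ℝ, |(G (circleMap 0 1 θ)).re - φ (θ : AddCircle (2 * π))| ≤ δ := by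
  have : Fact (0 < 2 * π) := ⟨Real.two_pi_pos⟩
  have hspan : ∀ T ∈ Submodule.span ℂ (Set.range (@fourier (2 * π))),
      ∃ G₁ G₂ : ℂ → ℂ, Differentiable ℂ G₁ ∧ Differentiable ℂ G₂ ∧
        ∀ θ : ℝ, T (θ : AddCircle (2 * π)) =
          G₁ (circleMap 0 1 θ) + (starRingEnd ℂ) (G₂ (circleMap 0 1 θ)) := by
    intro T hT
    induction hT using Submodule.span_induction with
    | mem T hT =>
      obtain ⟨n, rfl⟩ := hT
      have key : ∀ (m : ℕ) (θ : ℝ), fourier (m : ℤ) (θ : AddCircle (2 * π)) =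
          (circleMap 0 1 θ) ^ m := by
        intro m θ
        rw [fourier_coe_apply, circleMap, ofReal_one, one_mul, zero_add, ← Complex.exp_nat_mul]
        congr 1
        have : (π : ℂ) ≠ 0 := by exact_mod_cast Real.pi_ne_zero
        push_cast
        field_simp
      obtain ⟨m, rfl | rfl⟩ := n.eq_nat_or_neg
      · exact ⟨fun z => z ^ m, 0, by fun_prop, differentiable_const 0, fun θ => by
          rw [key]; simp⟩
      · exact ⟨0, fun z => z ^ m, differentiable_const 0, by fun_prop, fun θ => by
          rw [fourier_neg, key]; simp⟩
    | zero => exact ⟨0, 0, differentiable_const 0, differentiable_const 0, by simp⟩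
    | add S T _ _ hS hT =>
      obtain ⟨a, b, ha, hb, hab⟩ := hS
      obtain ⟨c, d, hc, hd, hcd⟩ := hT
      refine ⟨a + c, b + d, ha.add hc, hb.add hd, fun θ => ?_⟩
      simp only [ContinuousMap.add_apply, hab, hcd, Pi.add_apply, map_add]
      ring
    | smul k T _ hT =>
      obtain ⟨a, b, ha, hb, hab⟩ := hT
      refine ⟨fun z => k * a z, fun z => (starRingEnd ℂ) k * b z, ha.const_mul _, hb.const_mul _,
        fun θ => ?_⟩
      simp only [ContinuousMap.smul_apply, hab, smul_eq_mul, map_mul, Complex.conj_conj]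
      ring
  let ψ : C(AddCircle (2 * π), ℂ) := ⟨fun x => (φ x : ℂ), by fun_prop⟩
  have hψ : ψ ∈ closure (Submodule.span ℂ (Set.range (@fourier (2 * π))) : Set _) := by
    rw [← Submodule.topologicalClosure_coe, span_fourier_closure_eq_top]
    trivial
  obtain ⟨T, hT, hTd⟩ := Metric.mem_closure_iff.1 hψ δ hδ
  obtain ⟨G₁, G₂, h₁, h₂, h⟩ := hspan T hT
  refine ⟨fun z => G₁ z + G₂ z - ((G₁ 0 + G₂ 0).im : ℂ) * I, by fun_prop, by simp, fun θ => ?_⟩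
  have h3 : ‖T (θ : AddCircle (2 * π)) - ψ (θ : AddCircle (2 * π))‖ ≤ δ := by
    rw [← dist_eq_norm, dist_comm]
    exact (ContinuousMap.dist_apply_le_dist _).trans hTd.le
  refine le_trans (le_of_eq ?_) ((Complex.abs_re_le_norm _).trans h3)
  rw [h θ]
  simp [ψ]

theorem exists_norm_rpow_le {p : ℝ} (hp1 : 1 < p) (hp2 : p ≤ 2) :
    ∃ A B : ℝ, 0 ≤ A ∧ 0 ≤ B ∧ ∀ w : ℂ, 0 < w.re →
      ‖w‖ ^ p ≤ A * w.re ^ p - B * (w ^ (p : ℂ)).re := by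
  have hπ := Real.pi_pos
  obtain ⟨α, hα1, hα2⟩ : ∃ α, π / 2 / p < α ∧ α < π / 2 :=
    exists_between (div_lt_self (by positivity) hp1)
  have hα0 : 0 < α := lt_trans (by positivity) hα1
  have hpα : π / 2 < p * α := by rwa [div_lt_iff₀' (by linarith)] at hα1
  have hc : Real.cos (p * α) < 0 := Real.cos_neg_of_pi_div_two_lt_of_lt hpα (by nlinarith)
  have hcα : 0 < Real.cos α := Real.cos_pos_of_mem_Ioo ⟨by linarith, hα2⟩
  set c := -Real.cos (p * α) with hcdef
  have hc0 : 0 < c := by linarith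
  have hcp : 0 < Real.cos α ^ p := Real.rpow_pos_of_pos hcα p
  refine ⟨(1 + 1 / c) / Real.cos α ^ p, 1 / c, by positivity, by positivity, fun w hw => ?_⟩
  have hw0 : w ≠ 0 := by rintro rfl; simp at hw
  have hn : 0 < ‖w‖ := norm_pos_iff.2 hw0
  have harg : |arg w| < π / 2 := abs_arg_lt_pi_div_two_iff.2 (Or.inl hw)
  have hre : w.re = ‖w‖ * Real.cos |arg w| := by
    rw [Real.cos_abs, Complex.norm_mul_cos_arg]
  have hcpow : (w ^ (p : ℂ)).re = ‖w‖ ^ p * Real.cos (p * |arg w|) := by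
    rw [Complex.cpow_def_of_ne_zero hw0, Complex.exp_re, Complex.re_mul_ofReal,
      Complex.im_mul_ofReal, Complex.log_re, Complex.log_im, Real.rpow_def_of_pos hn]
    congr 1
    rw [← Real.cos_abs, abs_mul, abs_of_pos (by linarith : 0 < p), mul_comm]
  have hcos : 0 ≤ Real.cos |arg w| :=
    (Real.cos_pos_of_mem_Ioo ⟨by linarith [abs_nonneg (arg w)], harg⟩).le
  rw [hcpow, hre, Real.mul_rpow hn.le hcos]
  set t := |arg w| with ht
  have ht0 : 0 ≤ t := abs_nonneg _
  suffices H : 1 ≤ (1 + 1 / c) / Real.cos α ^ p * Real.cos t ^ p - 1 / c * Real.cos (p * t) by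
    nlinarith [mul_le_mul_of_nonneg_left H (Real.rpow_pos_of_pos hn p).le]
  rcases le_total α t with h | h
  · have h1 : Real.cos (p * t) ≤ Real.cos (p * α) :=
      Real.cos_le_cos_of_nonneg_of_le_pi (by positivity) (by nlinarith)
        (mul_le_mul_of_nonneg_left h (by linarith))
    have h2 : 1 ≤ 1 / c * (-Real.cos (p * t)) := by
      rw [one_div_mul_eq_div, le_div_iff₀ hc0]; linarith
    have h3 : 0 ≤ (1 + 1 / c) / Real.cos α ^ p * Real.cos t ^ p := by positivity
    linarith
  · have h1 : Real.cos α ^ p ≤ Real.cos t ^ p :=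
      Real.rpow_le_rpow hcα.le
        (Real.cos_le_cos_of_nonneg_of_le_pi ht0 (by linarith) h) (by linarith)
    have h2 : 1 + 1 / c ≤ (1 + 1 / c) / Real.cos α ^ p * Real.cos t ^ p := by
      rw [div_mul_eq_mul_div, le_div_iff₀ hcp]
      exact mul_le_mul_of_nonneg_left h1 (by positivity)
    have h3 : 1 / c * Real.cos (p * t) ≤ 1 / c * 1 :=
      mul_le_mul_of_nonneg_left (Real.cos_le_one _) (by positivity)
    linarith

theorem add_rpow_le_two_rpow_mul {a b p : ℝ} (ha : 0 ≤ a) (hb : 0 ≤ b) (hp : 0 ≤ p) :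
    (a + b) ^ p ≤ 2 ^ p * (a ^ p + b ^ p) := by
  have h1 : (a + b) ^ p ≤ (2 * max a b) ^ p :=
    Real.rpow_le_rpow (by positivity) (by linarith [le_max_left a b, le_max_right a b]) hp
  refine h1.trans ?_
  rw [Real.mul_rpow two_pos.le (le_max_of_le_left ha)]
  refine mul_le_mul_of_nonneg_left ?_ (by positivity)
  have := Real.rpow_nonneg ha p
  have := Real.rpow_nonneg hb p
  rcases max_choice a b with h | h <;> rw [h] <;> linarith

theorem DiffContOnCl.continuous_circleMap {F : ℂ → ℂ} (hF : DiffContOnCl ℂ F (Metric.ball 0 1)) :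
    Continuous fun θ : ℝ => F (circleMap 0 1 θ) := by
  have h := hF.continuousOn
  rw [closure_ball _ one_ne_zero] at h
  exact h.comp_continuous (_root_.continuous_circleMap 0 1)
    fun θ => circleMap_mem_closedBall 0 zero_le_one θ

/-- The minimum principle for the real part of a holomorphic function. -/
theorem DiffContOnCl.le_re_of_le_re_circleMap {G : ℂ → ℂ}
    (hG : DiffContOnCl ℂ G (Metric.ball 0 1)) {m : ℝ}
    (hm : ∀ θ : ℝ, m ≤ (G (circleMap 0 1 θ)).re) {z : ℂ}
    (hz : z ∈ closure (Metric.ball (0 : ℂ) 1)) : m ≤ (G z).re := by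
  have hE : DiffContOnCl ℂ (fun z => Complex.exp (-G z)) (Metric.ball 0 1) :=
    ⟨hG.1.neg.cexp, hG.2.neg.cexp⟩
  have h := Complex.norm_le_of_forall_mem_frontier_norm_le Metric.isBounded_ball hE
    (C := Real.exp (-m)) (fun w hw => ?_) hz
  · rw [Complex.norm_exp, Real.exp_le_exp, Complex.neg_re] at h
    linarith
  · rw [frontier_ball _ one_ne_zero, ← abs_one, ← range_circleMap] at hw
    obtain ⟨θ, rfl⟩ := hw
    rw [Complex.norm_exp, Real.exp_le_exp, Complex.neg_re]
    linarith [hm θ]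

theorem integral_norm_rpow_le_of_re_pos {p A B : ℝ} (hp : 0 < p) (hB : 0 ≤ B)
    (hAB : ∀ w : ℂ, 0 < w.re → ‖w‖ ^ p ≤ A * w.re ^ p - B * (w ^ (p : ℂ)).re)
    {G : ℂ → ℂ} (hG : DiffContOnCl ℂ G (Metric.ball 0 1)) (hG0 : (G 0).im = 0) {m : ℝ}
    (hm0 : 0 < m) (hm : ∀ θ : ℝ, m ≤ (G (circleMap 0 1 θ)).re) :
    ∫ θ in (0 : ℝ)..(2 * π), ‖G (circleMap 0 1 θ)‖ ^ p ≤
      A * ∫ θ in (0 : ℝ)..(2 * π), (G (circleMap 0 1 θ)).re ^ p := by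
  have hpos : ∀ z ∈ closure (Metric.ball (0 : ℂ) 1), 0 < (G z).re := fun z hz =>
    hm0.trans_le (hG.le_re_of_le_re_circleMap hm hz)
  have hH : DiffContOnCl ℂ (fun z => G z ^ (p : ℂ)) (Metric.ball 0 1) := by
    refine ⟨fun z hz => ?_, fun z hz => ?_⟩
    · exact (hG.1 z hz).cpow_const (Or.inl (hpos z (subset_closure hz)))
    · exact (hG.2 z hz).cpow continuousWithinAt_const (Or.inl (hpos z hz))
  have hGc := hG.continuous_circleMap
  have hHc := hH.continuous_circleMap
  have hmean : ∫ θ in (0 : ℝ)..(2 * π), (G (circleMap 0 1 θ) ^ (p : ℂ)).re =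
      2 * π * (G 0 ^ (p : ℂ)).re := by
    have h1 := DiffContOnCl.circleAverage (c := (0 : ℂ)) (R := 1)
      (f := fun z => G z ^ (p : ℂ)) (by simpa using hH)
    rw [Real.circleAverage_def] at h1
    have h2 := congrArg Complex.re h1
    rw [Complex.smul_re, smul_eq_mul, inv_mul_eq_iff_eq_mul₀ (by positivity)] at h2
    rw [← h2]
    exact intervalIntegral.intervalIntegral_re (hHc.intervalIntegrable _ _)
  have h0 : 0 ≤ (G 0 ^ (p : ℂ)).re := by
    have h1 := hpos 0 (subset_closure (by simp))
    have h2 : G 0 = ((G 0).re : ℂ) := by apply Complex.ext <;> simp [hG0]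
    rw [h2, ← Complex.ofReal_cpow h1.le, Complex.ofReal_re]
    positivity
  have hc1 : Continuous fun θ : ℝ => (G (circleMap 0 1 θ)).re ^ p :=
    (Complex.continuous_re.comp hGc).rpow_const fun _ => Or.inr hp.le
  have hc2 : Continuous fun θ : ℝ => (G (circleMap 0 1 θ) ^ (p : ℂ)).re :=
    Complex.continuous_re.comp hHc
  calc ∫ θ in (0 : ℝ)..(2 * π), ‖G (circleMap 0 1 θ)‖ ^ p
      ≤ ∫ θ in (0 : ℝ)..(2 * π), (A * (G (circleMap 0 1 θ)).re ^ p -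
          B * (G (circleMap 0 1 θ) ^ (p : ℂ)).re) := by
        refine intervalIntegral.integral_mono_on (by positivity)
          ((hGc.norm.rpow_const fun _ => Or.inr hp.le).intervalIntegrable _ _)
          (((hc1.const_mul A).sub (hc2.const_mul B)).intervalIntegrable _ _) fun θ _ => ?_
        exact hAB _ (hm0.trans_le (hm θ))
    _ = A * (∫ θ in (0 : ℝ)..(2 * π), (G (circleMap 0 1 θ)).re ^ p) -
          B * (2 * π * (G 0 ^ (p : ℂ)).re) := by
        rw [intervalIntegral.integral_sub ((hc1.const_mul A).intervalIntegrable _ _)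
          ((hc2.const_mul B).intervalIntegrable _ _), intervalIntegral.integral_const_mul,
          intervalIntegral.integral_const_mul, hmean]
    _ ≤ _ := by
        have : 0 ≤ B * (2 * π * (G 0 ^ (p : ℂ)).re) := by positivity
        linarith

/-- The M. Riesz inequality with constant `C` for functions vanishing at the origin. -/
def RieszBound (p C : ℝ) : Prop :=
  ∀ F : ℂ → ℂ, DiffContOnCl ℂ F (Metric.ball 0 1) → F 0 = 0 →
    ∫ θ in (0 : ℝ)..(2 * π), ‖F (circleMap 0 1 θ)‖ ^ p ≤
      C * ∫ θ in (0 : ℝ)..(2 * π), |(F (circleMap 0 1 θ)).re| ^ p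

theorem exists_rieszBound_of_le_two {p : ℝ} (hp1 : 1 < p) (hp2 : p ≤ 2) :
    ∃ C, RieszBound p C := by
  obtain ⟨A, B, hA, hB, hAB⟩ := exists_norm_rpow_le hp1 hp2
  have hp : 0 < p := by linarith
  refine ⟨2 ^ p * (2 * A * 2 ^ p), fun F hF hF0 => ?_⟩
  have hFc := hF.continuous_circleMap
  have hmain : ∀ η : ℝ, 0 < η → ∫ θ in (0 : ℝ)..(2 * π), ‖F (circleMap 0 1 θ)‖ ^ p ≤
      2 ^ p * (2 * A * ∫ θ in (0 : ℝ)..(2 * π), (|(F (circleMap 0 1 θ)).re| + η) ^ p) := by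
    intro η hη
    have hFs : Continuous fun x : AddCircle (2 * π) => F (AddCircle.toCircle x : ℂ) := by
      have h := hF.continuousOn
      rw [closure_ball _ one_ne_zero] at h
      exact h.comp_continuous (by fun_prop) fun x => by simp [Circle.norm_coe]
    obtain ⟨G, hG, hG0, hGa⟩ := exists_entire_re_approx
      ⟨fun x => max (F (AddCircle.toCircle x : ℂ)).re 0 + 2 * η / 3,
        ((Complex.continuous_re.comp hFs).max continuous_const).add_const _⟩
      (δ := η / 3) (by positivity)
    have hcirc : ∀ θ : ℝ, ((AddCircle.toCircle (θ : AddCircle (2 * π)) : Circle) : ℂ) =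
        circleMap 0 1 θ := by
      intro θ
      rw [AddCircle.toCircle_apply_mk, div_self (by positivity)]
      simp [circleMap]
    simp only [ContinuousMap.coe_mk, hcirc, abs_le] at hGa
    have hGd : DiffContOnCl ℂ G (Metric.ball 0 1) := hG.diffContOnCl
    have hKd : DiffContOnCl ℂ (G - F) (Metric.ball 0 1) := hGd.sub hF
    have hGc := hGd.continuous_circleMap
    have hKc := hKd.continuous_circleMap
    have hGl : ∀ θ : ℝ, η / 3 ≤ (G (circleMap 0 1 θ)).re := fun θ => by
      linarith [(hGa θ).1, le_max_right (F (circleMap 0 1 θ)).re 0]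
    have hKl : ∀ θ : ℝ, η / 3 ≤ ((G - F) (circleMap 0 1 θ)).re := fun θ => by
      rw [Pi.sub_apply, Complex.sub_re]
      linarith [(hGa θ).1, le_max_left (F (circleMap 0 1 θ)).re 0]
    have hGu : ∀ θ : ℝ, (G (circleMap 0 1 θ)).re ≤ |(F (circleMap 0 1 θ)).re| + η := fun θ => by
      linarith [(hGa θ).2, max_le (le_abs_self (F (circleMap 0 1 θ)).re) (abs_nonneg _)]
    have hKu : ∀ θ : ℝ, ((G - F) (circleMap 0 1 θ)).re ≤ |(F (circleMap 0 1 θ)).re| + η :=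
      fun θ => by
        rw [Pi.sub_apply, Complex.sub_re]
        have : max (F (circleMap 0 1 θ)).re 0 ≤
            |(F (circleMap 0 1 θ)).re| + (F (circleMap 0 1 θ)).re :=
          max_le (by linarith [abs_nonneg (F (circleMap 0 1 θ)).re])
            (by linarith [neg_abs_le (F (circleMap 0 1 θ)).re])
        linarith [(hGa θ).2]
    have hUc : Continuous fun θ : ℝ => (|(F (circleMap 0 1 θ)).re| + η) ^ p :=
      ((Complex.continuous_re.comp hFc).abs.add_const η).rpow_const fun _ => Or.inr hp.le
    have bound : ∀ K : ℂ → ℂ, DiffContOnCl ℂ K (Metric.ball 0 1) → (K 0).im = 0 →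
        (∀ θ : ℝ, η / 3 ≤ (K (circleMap 0 1 θ)).re) →
        (∀ θ : ℝ, (K (circleMap 0 1 θ)).re ≤ |(F (circleMap 0 1 θ)).re| + η) →
        ∫ θ in (0 : ℝ)..(2 * π), ‖K (circleMap 0 1 θ)‖ ^ p ≤
          A * ∫ θ in (0 : ℝ)..(2 * π), (|(F (circleMap 0 1 θ)).re| + η) ^ p := by
      intro K hK hK0 hl hu
      refine (integral_norm_rpow_le_of_re_pos hp hB hAB hK hK0 (by positivity) hl).trans
        (mul_le_mul_of_nonneg_left ?_ hA)
      refine intervalIntegral.integral_mono_on (by positivity)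
        (((Complex.continuous_re.comp hK.continuous_circleMap).rpow_const
          fun _ => Or.inr hp.le).intervalIntegrable _ _) (hUc.intervalIntegrable _ _)
        fun θ _ => ?_
      exact Real.rpow_le_rpow (by linarith [hl θ]) (hu θ) hp.le
    have b1 := bound G hGd hG0 hGl hGu
    have b2 := bound (G - F) hKd (by simp [hG0, hF0]) hKl hKu
    have hG1 : Continuous fun θ : ℝ => ‖G (circleMap 0 1 θ)‖ ^ p :=
      hGc.norm.rpow_const fun _ => Or.inr hp.le
    have hK1 : Continuous fun θ : ℝ => ‖(G - F) (circleMap 0 1 θ)‖ ^ p :=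
      hKc.norm.rpow_const fun _ => Or.inr hp.le
    calc ∫ θ in (0 : ℝ)..(2 * π), ‖F (circleMap 0 1 θ)‖ ^ p
        ≤ ∫ θ in (0 : ℝ)..(2 * π), 2 ^ p * (‖G (circleMap 0 1 θ)‖ ^ p +
            ‖(G - F) (circleMap 0 1 θ)‖ ^ p) := by
          refine intervalIntegral.integral_mono_on (by positivity)
            ((hFc.norm.rpow_const fun _ => Or.inr hp.le).intervalIntegrable _ _)
            (((hG1.add hK1).const_mul _).intervalIntegrable _ _) fun θ _ => ?_
          refine le_trans (Real.rpow_le_rpow (norm_nonneg _) ?_ hp.le)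
            (add_rpow_le_two_rpow_mul (norm_nonneg _) (norm_nonneg _) hp.le)
          calc ‖F (circleMap 0 1 θ)‖
              = ‖G (circleMap 0 1 θ) - (G - F) (circleMap 0 1 θ)‖ := by simp
            _ ≤ _ := norm_sub_le _ _
      _ = 2 ^ p * ((∫ θ in (0 : ℝ)..(2 * π), ‖G (circleMap 0 1 θ)‖ ^ p) +
            ∫ θ in (0 : ℝ)..(2 * π), ‖(G - F) (circleMap 0 1 θ)‖ ^ p) := by
          rw [intervalIntegral.integral_const_mul, intervalIntegral.integral_add
            (hG1.intervalIntegrable _ _) (hK1.intervalIntegrable _ _)]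
      _ ≤ _ := mul_le_mul_of_nonneg_left (by linarith) (by positivity)
  have hu : Continuous fun θ : ℝ => |(F (circleMap 0 1 θ)).re| ^ p :=
    (Complex.continuous_re.comp hFc).abs.rpow_const fun _ => Or.inr hp.le
  have hlim : ∀ η : ℝ, 0 < η → ∫ θ in (0 : ℝ)..(2 * π), ‖F (circleMap 0 1 θ)‖ ^ p ≤
      2 ^ p * (2 * A * 2 ^ p) * ((∫ θ in (0 : ℝ)..(2 * π), |(F (circleMap 0 1 θ)).re| ^ p) +
        2 * π * η ^ p) := by
    intro η hη
    refine (hmain η hη).trans ?_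
    rw [mul_assoc (2 ^ p : ℝ), mul_assoc (2 * A)]
    refine mul_le_mul_of_nonneg_left (mul_le_mul_of_nonneg_left ?_ (by positivity))
      (by positivity)
    have hint : ∫ θ in (0 : ℝ)..(2 * π), 2 ^ p * (|(F (circleMap 0 1 θ)).re| ^ p + η ^ p) =
        2 ^ p * ((∫ θ in (0 : ℝ)..(2 * π), |(F (circleMap 0 1 θ)).re| ^ p) +
          2 * π * η ^ p) := by
      rw [intervalIntegral.integral_const_mul, intervalIntegral.integral_add
        (hu.intervalIntegrable _ _) (by simp), intervalIntegral.integral_const]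
      simp
    rw [← hint]
    refine intervalIntegral.integral_mono_on (by positivity)
      ((((Complex.continuous_re.comp hFc).abs.add_const η).rpow_const
        fun _ => Or.inr hp.le).intervalIntegrable _ _)
      (((hu.add_const _).const_mul _).intervalIntegrable _ _) fun θ _ => ?_
    exact add_rpow_le_two_rpow_mul (abs_nonneg _) hη.le hp.le
  have htend : Filter.Tendsto (fun η : ℝ => 2 ^ p * (2 * A * 2 ^ p) *
      ((∫ θ in (0 : ℝ)..(2 * π), |(F (circleMap 0 1 θ)).re| ^ p) + 2 * π * η ^ p))
      (nhdsWithin 0 (Set.Ioi 0)) (nhds (2 ^ p * (2 * A * 2 ^ p) *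
      ((∫ θ in (0 : ℝ)..(2 * π), |(F (circleMap 0 1 θ)).re| ^ p) + 2 * π * (0 : ℝ) ^ p))) := by
    refine Filter.Tendsto.mono_left (Continuous.tendsto ?_ 0) nhdsWithin_le_nhds
    exact continuous_const.mul (continuous_const.add (continuous_const.mul
      (continuous_id.rpow_const fun _ => Or.inr hp.le)))
  have := ge_of_tendsto htend (Filter.eventually_of_mem self_mem_nhdsWithin hlim)
  simpa [Real.zero_rpow hp.ne'] using this

theorem RieszBound.two_mul {p C : ℝ} (hp : 0 < p) (hC : RieszBound p C) :
    RieszBound (2 * p) ((|C| * 2 ^ p) ^ 2) := by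
  intro F hF hF0
  have hFc := hF.continuous_circleMap
  have hre : Continuous fun θ : ℝ => |(F (circleMap 0 1 θ)).re| :=
    (Complex.continuous_re.comp hFc).abs
  have hsq : ∀ x : ℝ, 0 ≤ x → x ^ (2 * p) = (x ^ p) ^ 2 := fun x hx => by
    rw [mul_comm, Real.rpow_mul hx, Real.rpow_two]
  have hd : DiffContOnCl ℂ (fun z => -I * F z ^ 2) (Metric.ball 0 1) := by
    refine ⟨(hF.1.pow 2).const_mul _, (hF.2.pow 2).const_smul (-I)⟩
  have h1 := hC (fun z => -I * F z ^ 2) hd (by simp [hF0])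
  have hl : ∀ θ : ℝ, ‖-I * F (circleMap 0 1 θ) ^ 2‖ ^ p = ‖F (circleMap 0 1 θ)‖ ^ (2 * p) := by
    intro θ
    rw [hsq _ (norm_nonneg _), norm_mul, norm_pow, norm_neg, Complex.norm_I, one_mul,
      ← Real.rpow_natCast, ← Real.rpow_natCast, ← Real.rpow_mul (norm_nonneg _),
      ← Real.rpow_mul (norm_nonneg _), mul_comm]
  simp only [hl] at h1
  have hXc : Continuous fun θ : ℝ => ‖F (circleMap 0 1 θ)‖ ^ (2 * p) :=
    hFc.norm.rpow_const fun _ => Or.inr (by positivity)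
  have hUc : Continuous fun θ : ℝ => |(F (circleMap 0 1 θ)).re| ^ (2 * p) :=
    hre.rpow_const fun _ => Or.inr (by positivity)
  have hHc : Continuous fun θ : ℝ => |(-I * F (circleMap 0 1 θ) ^ 2).re| ^ p :=
    (Complex.continuous_re.comp hd.continuous_circleMap).abs.rpow_const fun _ => Or.inr hp.le
  have h2 : |C| * ∫ θ in (0 : ℝ)..(2 * π), |(-I * F (circleMap 0 1 θ) ^ 2).re| ^ p ≤
      1 / 2 * (∫ θ in (0 : ℝ)..(2 * π), ‖F (circleMap 0 1 θ)‖ ^ (2 * p)) +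
      (|C| * 2 ^ p) ^ 2 / 2 * ∫ θ in (0 : ℝ)..(2 * π), |(F (circleMap 0 1 θ)).re| ^ (2 * p) := by
    rw [← intervalIntegral.integral_const_mul, ← intervalIntegral.integral_const_mul,
      ← intervalIntegral.integral_const_mul, ← intervalIntegral.integral_add
        ((hXc.const_mul _).intervalIntegrable _ _) ((hUc.const_mul _).intervalIntegrable _ _)]
    refine intervalIntegral.integral_mono_on (by positivity)
      ((hHc.const_mul _).intervalIntegrable _ _)
      (((hXc.const_mul _).add (hUc.const_mul _)).intervalIntegrable _ _) fun θ _ => ?_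
    set w := F (circleMap 0 1 θ)
    have hw : |(-I * w ^ 2).re| ≤ 2 * |w.re| * ‖w‖ := by
      have : (-I * w ^ 2).re = 2 * w.re * w.im := by
        simp [pow_two]; ring
      rw [this, abs_mul, abs_mul, abs_two]
      exact mul_le_mul_of_nonneg_left (Complex.abs_im_le_norm w) (by positivity)
    have hw' : |(-I * w ^ 2).re| ^ p ≤ 2 ^ p * |w.re| ^ p * ‖w‖ ^ p := by
      rw [← Real.mul_rpow (by positivity) (by positivity),
        ← Real.mul_rpow (by positivity) (by positivity)]
      exact Real.rpow_le_rpow (abs_nonneg _) hw hp.le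
    have hw'' := mul_le_mul_of_nonneg_left hw' (abs_nonneg C)
    rw [hsq _ (norm_nonneg _), hsq _ (abs_nonneg _)]
    nlinarith [sq_nonneg (‖w‖ ^ p - |C| * 2 ^ p * |w.re| ^ p)]
  have h3 : C * ∫ θ in (0 : ℝ)..(2 * π), |(-I * F (circleMap 0 1 θ) ^ 2).re| ^ p ≤
      |C| * ∫ θ in (0 : ℝ)..(2 * π), |(-I * F (circleMap 0 1 θ) ^ 2).re| ^ p :=
    mul_le_mul_of_nonneg_right (le_abs_self C)
      (intervalIntegral.integral_nonneg (by positivity) fun θ _ => by positivity)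
  linarith

/-- The M. Riesz theorem on conjugate functions. -/
theorem exists_rieszBound {p : ℝ} (hp : 1 < p) : ∃ C, RieszBound p C := by
  have key : ∀ n : ℕ, ∀ p : ℝ, 1 < p → p ≤ 2 * 2 ^ n → ∃ C, RieszBound p C := by
    intro n
    induction n with
    | zero => exact fun p h1 h2 => exists_rieszBound_of_le_two h1 (by simpa using h2)
    | succ n ih =>
      intro p h1 h2
      rcases le_or_gt p 2 with h | h
      · exact exists_rieszBound_of_le_two h1 h
      · obtain ⟨C, hC⟩ := ih (p / 2) (by linarith) (by rw [pow_succ] at h2; linarith)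
        have := hC.two_mul (by linarith)
        rw [mul_div_cancel₀ p two_ne_zero] at this
        exact ⟨_, this⟩
  obtain ⟨n, hn⟩ := pow_unbounded_of_one_lt p one_lt_two
  exact key n p hp (by linarith)

theorem inHardy_iff_integral_le {p : ℝ} (hp : 0 < p) {f : ℂ → ℂ} :
    InHardy p f ↔ ∃ C : ℝ, ∀ r : ℝ, 0 < r → r < 1 →
      ∫ θ in (0 : ℝ)..(2 * π), ‖f (r * circleMap 0 1 θ)‖ ^ p ≤ C := by
  have hcm : ∀ r : ℝ, circleMean p f r =
      ((1 / (2 * π)) * ∫ θ in (0 : ℝ)..(2 * π), ‖f (r * circleMap 0 1 θ)‖ ^ p) ^ (1 / p) := by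
    intro r
    simp [circleMean, circleMap]
  have h0 : ∀ r : ℝ, 0 ≤ ∫ θ in (0 : ℝ)..(2 * π), ‖f (r * circleMap 0 1 θ)‖ ^ p := fun r =>
    intervalIntegral.integral_nonneg (by positivity) fun θ _ => by positivity
  constructor
  · rintro ⟨C, hC⟩
    refine ⟨2 * π * C ^ p, fun r hr hr1 => ?_⟩
    have h := hC r hr hr1
    rw [hcm] at h
    have hr0 := h0 r
    have h' := Real.rpow_le_rpow (by positivity) h hp.le
    rw [← Real.rpow_mul (by positivity), one_div_mul_cancel hp.ne', Real.rpow_one,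
      one_div_mul_eq_div, div_le_iff₀' (by positivity)] at h'
    exact h'
  · rintro ⟨C, hC⟩
    refine ⟨((1 / (2 * π)) * C) ^ (1 / p), fun r hr hr1 => ?_⟩
    have hr0 := h0 r
    rw [hcm]
    exact Real.rpow_le_rpow (by positivity)
      (mul_le_mul_of_nonneg_left (hC r hr hr1) (by positivity)) (by positivity)

theorem mul_circleMap_mem_unitDisk {r : ℝ} (hr : 0 < r) (hr1 : r < 1) (θ : ℝ) :
    (r : ℂ) * circleMap 0 1 θ ∈ unitDisk := by
  simp [unitDisk, abs_of_pos hr, hr1]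

theorem DifferentiableOn.diffContOnCl_dilation {h : ℂ → ℂ} (hh : DifferentiableOn ℂ h unitDisk)
    {r : ℝ} (hr : 0 < r) (hr1 : r < 1) :
    DiffContOnCl ℂ (fun z => h (r * z)) (Metric.ball 0 1) := by
  refine DifferentiableOn.diffContOnCl ?_
  rw [closure_ball _ one_ne_zero]
  refine hh.comp (by fun_prop) fun z hz => ?_
  rw [mem_closedBall_zero_iff] at hz
  rw [unitDisk, mem_ball_zero_iff, norm_mul, Complex.norm_real, Real.norm_of_nonneg hr.le]
  nlinarith [norm_nonneg z]

theorem InHardy.linear_combination {p : ℝ} (hp : 0 < p) {h k : ℂ → ℂ}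
    (hh : DifferentiableOn ℂ h unitDisk) (hk : DifferentiableOn ℂ k unitDisk)
    (hhp : InHardy p h) (hkp : InHardy p k) (a b : ℂ) :
    InHardy p fun z => a * h z + b * k z := by
  rw [inHardy_iff_integral_le hp] at hhp hkp ⊢
  obtain ⟨C, hC⟩ := hhp
  obtain ⟨D, hD⟩ := hkp
  refine ⟨2 ^ p * (‖a‖ ^ p * C + ‖b‖ ^ p * D), fun r hr hr1 => ?_⟩
  have hhc := (hh.diffContOnCl_dilation hr hr1).continuous_circleMap
  have hkc := (hk.diffContOnCl_dilation hr hr1).continuous_circleMap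
  have hh1 : Continuous fun θ : ℝ => ‖h (r * circleMap 0 1 θ)‖ ^ p :=
    hhc.norm.rpow_const fun _ => Or.inr hp.le
  have hk1 : Continuous fun θ : ℝ => ‖k (r * circleMap 0 1 θ)‖ ^ p :=
    hkc.norm.rpow_const fun _ => Or.inr hp.le
  calc ∫ θ in (0 : ℝ)..(2 * π), ‖a * h (r * circleMap 0 1 θ) + b * k (r * circleMap 0 1 θ)‖ ^ p
      ≤ ∫ θ in (0 : ℝ)..(2 * π), 2 ^ p * (‖a‖ ^ p * ‖h (r * circleMap 0 1 θ)‖ ^ p +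
          ‖b‖ ^ p * ‖k (r * circleMap 0 1 θ)‖ ^ p) := by
        refine intervalIntegral.integral_mono_on (by positivity)
          ((((hhc.const_mul a).add (hkc.const_mul b)).norm.rpow_const
            fun _ => Or.inr hp.le).intervalIntegrable _ _)
          ((((hh1.const_mul _).add (hk1.const_mul _)).const_mul _).intervalIntegrable _ _)
          fun θ _ => ?_
        rw [← Real.mul_rpow (norm_nonneg _) (norm_nonneg _),
          ← Real.mul_rpow (norm_nonneg _) (norm_nonneg _), ← norm_mul, ← norm_mul]
        exact (Real.rpow_le_rpow (norm_nonneg _) (norm_add_le _ _) hp.le).trans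
          (add_rpow_le_two_rpow_mul (norm_nonneg _) (norm_nonneg _) hp.le)
    _ = 2 ^ p * (‖a‖ ^ p * (∫ θ in (0 : ℝ)..(2 * π), ‖h (r * circleMap 0 1 θ)‖ ^ p) +
          ‖b‖ ^ p * ∫ θ in (0 : ℝ)..(2 * π), ‖k (r * circleMap 0 1 θ)‖ ^ p) := by
        rw [intervalIntegral.integral_const_mul, intervalIntegral.integral_add
          ((hh1.const_mul _).intervalIntegrable _ _) ((hk1.const_mul _).intervalIntegrable _ _),
          intervalIntegral.integral_const_mul, intervalIntegral.integral_const_mul]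
    _ ≤ _ := by
        have := hC r hr hr1
        have := hD r hr hr1
        gcongr

theorem inHardy_const {p : ℝ} (hp : 0 < p) (c : ℂ) : InHardy p fun _ => c :=
  (inHardy_iff_integral_le hp).2 ⟨_, fun _ _ _ => le_of_eq (by rw [intervalIntegral.integral_const])⟩

/-- An analytic function whose real part is dominated by an `h^p` function is in `H^p`. -/
theorem inHardy_of_abs_re_le {p : ℝ} (hp : 1 < p) {k f : ℂ → ℂ}
    (hk : DifferentiableOn ℂ k unitDisk) (hfc : ContinuousOn f unitDisk)
    (hkf : ∀ z ∈ unitDisk, |(k z).re| ≤ ‖f z‖) (hfp : InHardy p f) : InHardy p k := by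
  obtain ⟨C, hC⟩ := exists_rieszBound hp
  have hp0 : 0 < p := by linarith
  have hk0 : DifferentiableOn ℂ (fun z => k z - k 0) unitDisk := hk.sub_const _
  have key : InHardy p fun z => k z - k 0 := by
    rw [inHardy_iff_integral_le hp0] at hfp ⊢
    obtain ⟨D, hD⟩ := hfp
    refine ⟨|C| * (2 ^ p * (D + 2 * π * ‖k 0‖ ^ p)), fun r hr hr1 => ?_⟩
    have hd := hk0.diffContOnCl_dilation hr hr1
    have hkc := hd.continuous_circleMap
    have hfcc : Continuous fun θ : ℝ => f (r * circleMap 0 1 θ) :=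
      hfc.comp_continuous (by fun_prop) fun θ => mul_circleMap_mem_unitDisk hr hr1 θ
    have hf1 : Continuous fun θ : ℝ => ‖f (r * circleMap 0 1 θ)‖ ^ p :=
      hfcc.norm.rpow_const fun _ => Or.inr hp0.le
    refine (hC _ hd (by simp)).trans ?_
    refine (mul_le_mul_of_nonneg_right (le_abs_self C) (intervalIntegral.integral_nonneg
      (by positivity) fun θ _ => by positivity)).trans ?_
    refine mul_le_mul_of_nonneg_left ?_ (abs_nonneg C)
    calc ∫ θ in (0 : ℝ)..(2 * π), |(k (r * circleMap 0 1 θ) - k 0).re| ^ p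
        ≤ ∫ θ in (0 : ℝ)..(2 * π), 2 ^ p * (‖f (r * circleMap 0 1 θ)‖ ^ p + ‖k 0‖ ^ p) := by
          refine intervalIntegral.integral_mono_on (by positivity)
            (((Complex.continuous_re.comp hkc).abs.rpow_const
              fun _ => Or.inr hp0.le).intervalIntegrable _ _)
            (((hf1.add_const _).const_mul _).intervalIntegrable _ _) fun θ _ => ?_
          refine le_trans (Real.rpow_le_rpow (abs_nonneg _) ?_ hp0.le)
            (add_rpow_le_two_rpow_mul (norm_nonneg _) (norm_nonneg _) hp0.le)
          rw [Complex.sub_re]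
          exact (abs_sub _ _).trans (add_le_add
            (hkf _ (mul_circleMap_mem_unitDisk hr hr1 θ)) (Complex.abs_re_le_norm _))
      _ = 2 ^ p * ((∫ θ in (0 : ℝ)..(2 * π), ‖f (r * circleMap 0 1 θ)‖ ^ p) +
            2 * π * ‖k 0‖ ^ p) := by
          rw [intervalIntegral.integral_const_mul, intervalIntegral.integral_add
            (hf1.intervalIntegrable _ _) (by simp), intervalIntegral.integral_const]
          simp
      _ ≤ _ := by
          have := hD r hr hr1
          gcongr
  simpa using InHardy.linear_combination hp0 hk0 (differentiableOn_const 1) key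
    (inHardy_const hp0 1) 1 (k 0)

/-- If `f = h + conj g ∈ h^p` for some `1 < p < ∞`, then `h, g ∈ H^p`. -/
theorem parts_in_Hp (p : ℝ) (hp1 : 1 < p) (h g f : ℂ → ℂ)
    (hh : DifferentiableOn ℂ h unitDisk) (hg : DifferentiableOn ℂ g unitDisk)
    (hg0 : g 0 = 0)
    (hf : ∀ z ∈ unitDisk, f z = h z + (starRingEnd ℂ) (g z))
    (hfp : InHardy p f) :
    InHardy p h ∧ InHardy p g := by
  have hp0 : 0 < p := by linarith
  have hfc : ContinuousOn f unitDisk :=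
    (hh.continuousOn.add (Complex.continuous_conj.comp_continuousOn hg.continuousOn)).congr hf
  have hs : DifferentiableOn ℂ (fun z => h z + g z) unitDisk := hh.add hg
  have hd : DifferentiableOn ℂ (fun z => -I * (h z - g z)) unitDisk := (hh.sub hg).const_mul _
  have h1 : InHardy p fun z => h z + g z := inHardy_of_abs_re_le hp1 hs hfc (fun z hz => by
    rw [show (h z + g z).re = (f z).re by simp [hf z hz]]
    exact Complex.abs_re_le_norm _) hfp
  have h2 : InHardy p fun z => -I * (h z - g z) := inHardy_of_abs_re_le hp1 hd hfc (fun z hz => by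
    rw [show (-I * (h z - g z)).re = (f z).im by simp [hf z hz]; ring]
    exact Complex.abs_im_le_norm _) hfp
  constructor
  · convert InHardy.linear_combination hp0 hs hd h1 h2 (1 / 2) (I / 2) using 2 with z
    linear_combination ((h z - g z) / 2) * Complex.I_sq
  · convert InHardy.linear_combination hp0 hs hd h1 h2 (1 / 2) (-I / 2) using 2 with z
    linear_combination (-(h z - g z) / 2) * Complex.I_sq
end
end

section
/- Let f = h + conj(g) be a harmonic function in the unit disk 𝔻 (h, g analytic in 𝔻, g(0)=0). If f ∈ h¹, then for every p with 0 < p < 1, both h and g belong to the Hardy space H^p. -/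
open Complex Real Set

noncomputable section

/-- The Cauchy transform of a function on the circle of radius `R` about the origin. -/
def cauchyTransform (R : ℝ) (k : ℂ → ℂ) (z : ℂ) : ℂ :=
  circleAverage (fun ζ ↦ ζ / (ζ - z) * k ζ) 0 R

lemma half_le_re_div_sub {ζ z : ℂ} (h : ‖z‖ < ‖ζ‖) : 1 / 2 ≤ (ζ / (ζ - z)).re := by
  have hne : ζ - z ≠ 0 := fun h0 ↦ h.ne (by rw [sub_eq_zero.1 h0])
  have hsq : normSq z < normSq ζ := by
    rw [normSq_eq_norm_sq, normSq_eq_norm_sq]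
    exact pow_lt_pow_left₀ h (norm_nonneg z) two_ne_zero
  have hpos : 0 < normSq (ζ - z) := normSq_pos.2 hne
  rw [div_re, ← add_div, le_div_iff₀ hpos]
  simp only [normSq_apply, sub_re, sub_im] at *
  linarith

lemma sub_ne_zero_of_mem_sphere {R : ℝ} {ζ z : ℂ} (hζ : ζ ∈ Metric.sphere (0 : ℂ) R)
    (hz : z ∈ Metric.ball (0 : ℂ) R) : ζ - z ≠ 0 := by
  intro h0
  rw [mem_sphere_zero_iff_norm] at hζ
  rw [mem_ball_zero_iff, ← sub_eq_zero.1 h0] at hz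
  exact hz.ne hζ

lemma continuousOn_cauchyKernel_mul {R : ℝ} {k : ℂ → ℂ} (hk : ContinuousOn k (Metric.sphere 0 R))
    {z : ℂ} (hz : z ∈ Metric.ball (0 : ℂ) R) :
    ContinuousOn (fun ζ ↦ ζ / (ζ - z) * k ζ) (Metric.sphere 0 R) :=
  (continuousOn_id.div (continuousOn_id.sub continuousOn_const)
    fun _ hζ ↦ sub_ne_zero_of_mem_sphere hζ hz).mul hk

lemma differentiableOn_cauchyTransform {R : ℝ} (hR : 0 < R) {k : ℂ → ℂ}
    (hk : ContinuousOn k (Metric.sphere 0 R)) :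
    DifferentiableOn ℂ (cauchyTransform R k) (Metric.ball 0 R) := by
  lift R to NNReal using hR.le
  have h := (hasFPowerSeriesOn_cauchy_integral
    (hk.circleIntegrable hR.le) (by exact_mod_cast hR)).differentiableOn
  rw [Metric.eball_coe] at h
  refine h.congr fun z hz ↦ ?_
  rw [cauchyTransform, circleAverage_eq_circleIntegral hR.ne']
  congr 1
  refine circleIntegral.integral_congr hR.le fun ζ hζ ↦ ?_
  have hζ0 : ζ ≠ 0 := Metric.ne_of_mem_sphere hζ hR.ne'
  simp only [smul_eq_mul, sub_zero]
  field_simp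

lemma cos_mul_norm_rpow_le_re_cpow {p : ℝ} (hp0 : 0 < p) (hp1 : p < 1) {w : ℂ} (hw : 0 < w.re) :
    Real.cos (p * (π / 2)) * ‖w‖ ^ p ≤ (w ^ (p : ℂ)).re := by
  rw [cpow_ofReal_re, mul_comm]
  have harg := abs_arg_le_pi_div_two_iff.2 hw.le
  refine mul_le_mul_of_nonneg_left ?_ (by positivity)
  rw [← Real.cos_abs (arg w * p), abs_mul, abs_of_pos hp0, mul_comm p]
  exact Real.cos_le_cos_of_nonneg_of_le_pi (by positivity) (by nlinarith [pi_pos])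
    (mul_le_mul_of_nonneg_right harg hp0.le)

lemma cos_mul_circleAverage_norm_rpow_le {p : ℝ} (hp0 : 0 < p) (hp1 : p < 1) {G : ℂ → ℂ}
    {R r : ℝ} (hr : 0 < r) (hrR : r < R) (hG : DifferentiableOn ℂ G (Metric.ball 0 R))
    (hre : ∀ z ∈ Metric.ball 0 R, 0 < (G z).re) :
    Real.cos (p * (π / 2)) * circleAverage (fun z ↦ ‖G z‖ ^ p) 0 r ≤ ‖G 0‖ ^ p := by
  have hsub : Metric.closedBall (0 : ℂ) r ⊆ Metric.ball 0 R := Metric.closedBall_subset_ball hrR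
  have hsph : Metric.sphere (0 : ℂ) r ⊆ Metric.ball 0 R :=
    Metric.sphere_subset_closedBall.trans hsub
  have hpow : DifferentiableOn ℂ (fun z ↦ G z ^ (p : ℂ)) (Metric.ball 0 R) :=
    hG.cpow_const fun z hz ↦ Or.inl (hre z hz)
  have hmean : circleAverage (fun z ↦ G z ^ (p : ℂ)) 0 r = G 0 ^ (p : ℂ) := by
    apply DiffContOnCl.circleAverage
    rw [abs_of_pos hr]
    exact (hpow.mono (Metric.closure_ball_subset_closedBall.trans hsub)).diffContOnCl
  have hint : CircleIntegrable (fun z ↦ G z ^ (p : ℂ)) 0 r :=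
    (hpow.continuousOn.mono hsph).circleIntegrable hr.le
  have hmean_re : circleAverage (fun z ↦ (G z ^ (p : ℂ)).re) 0 r = (G 0 ^ (p : ℂ)).re := by
    rw [← hmean]
    exact reCLM.circleAverage_comp_comm hint
  have hnorm : ContinuousOn (fun z ↦ ‖G z‖ ^ p) (Metric.sphere 0 r) :=
    (hG.continuousOn.mono hsph).norm.rpow_const fun _ _ ↦ Or.inr hp0.le
  calc Real.cos (p * (π / 2)) * circleAverage (fun z ↦ ‖G z‖ ^ p) 0 r
      = circleAverage (fun z ↦ Real.cos (p * (π / 2)) * ‖G z‖ ^ p) 0 r := by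
        rw [← smul_eq_mul, ← circleAverage_fun_smul]; rfl
    _ ≤ circleAverage (fun z ↦ (G z ^ (p : ℂ)).re) 0 r := by
        refine circleAverage_mono ((continuousOn_const.mul hnorm).circleIntegrable hr.le)
          ((continuous_re.comp_continuousOn (hpow.continuousOn.mono hsph)).circleIntegrable hr.le)
          fun z hz ↦ ?_
        rw [abs_of_pos hr] at hz
        exact cos_mul_norm_rpow_le_re_cpow hp0 hp1 (hre z (hsph hz))
    _ = (G 0 ^ (p : ℂ)).re := hmean_re
    _ ≤ ‖G 0 ^ (p : ℂ)‖ := re_le_norm _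
    _ = ‖G 0‖ ^ p := norm_cpow_real _ _

lemma cauchyTransform_re_pos {R : ℝ} (hR : 0 < R) {u : ℂ → ℝ}
    (hu : ContinuousOn u (Metric.sphere 0 R)) (hu1 : ∀ ζ, 1 ≤ u ζ) {z : ℂ}
    (hz : z ∈ Metric.ball 0 R) : 0 < (cauchyTransform R (fun ζ ↦ u ζ) z).re := by
  have hc := continuousOn_cauchyKernel_mul (continuous_ofReal.comp_continuousOn hu) hz
  have hre : (cauchyTransform R (fun ζ ↦ u ζ) z).re
      = circleAverage (fun ζ ↦ (ζ / (ζ - z) * u ζ).re) 0 R :=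
    (reCLM.circleAverage_comp_comm (hc.circleIntegrable hR.le)).symm
  rw [hre]
  refine lt_of_lt_of_le one_half_pos ?_
  rw [← circleAverage_const (1 / 2 : ℝ) 0 R]
  refine circleAverage_mono (continuousOn_const.circleIntegrable hR.le)
    ((continuous_re.comp_continuousOn hc).circleIntegrable hR.le) fun ζ hζ ↦ ?_
  rw [abs_of_pos hR, mem_sphere_zero_iff_norm] at hζ
  rw [mem_ball_zero_iff] at hz
  have hker := half_le_re_div_sub (hz.trans_eq hζ.symm)
  rw [re_mul_ofReal]
  nlinarith [hu1 ζ]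

lemma cos_mul_circleAverage_cauchyTransform_ofReal_le {p : ℝ} (hp0 : 0 < p) (hp1 : p < 1)
    {R r : ℝ} (hr : 0 < r) (hrR : r < R) {u : ℂ → ℝ} (hu : ContinuousOn u (Metric.sphere 0 R))
    (hu1 : ∀ ζ, 1 ≤ u ζ) :
    Real.cos (p * (π / 2)) * circleAverage (fun z ↦ ‖cauchyTransform R (fun ζ ↦ u ζ) z‖ ^ p) 0 r
      ≤ circleAverage u 0 R ^ p := by
  have hR := hr.trans hrR
  have hzero : cauchyTransform R (fun ζ ↦ u ζ) 0 = (circleAverage u 0 R : ℝ) := by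
    have hcomm := ofRealCLM.circleAverage_comp_comm (hu.circleIntegrable hR.le)
    refine Eq.trans (circleAverage_congr_sphere fun ζ hζ ↦ ?_) hcomm
    have hζ0 : ζ ≠ 0 := Metric.ne_of_mem_sphere hζ (abs_pos.2 hR.ne').ne'
    simp [hζ0]
  refine (cos_mul_circleAverage_norm_rpow_le hp0 hp1 hr hrR
    (G := cauchyTransform R fun ζ ↦ u ζ) (differentiableOn_cauchyTransform hR
    (continuous_ofReal.comp_continuousOn hu)) fun z hz ↦
      cauchyTransform_re_pos hR hu hu1 hz).trans_eq ?_
  rw [hzero, norm_real, Real.norm_of_nonneg]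
  exact circleAverage_nonneg_of_nonneg fun ζ _ ↦ zero_le_one.trans (hu1 ζ)

lemma cauchyTransform_add {R : ℝ} {k l : ℂ → ℂ} (hk : ContinuousOn k (Metric.sphere 0 R))
    (hl : ContinuousOn l (Metric.sphere 0 R)) {z : ℂ} (hz : z ∈ Metric.ball 0 R) :
    cauchyTransform R (fun ζ ↦ k ζ + l ζ) z = cauchyTransform R k z + cauchyTransform R l z := by
  have hR : 0 ≤ R := (norm_nonneg z).trans (mem_ball_zero_iff.1 hz).le
  simp only [cauchyTransform, mul_add]
  exact circleAverage_fun_add ((continuousOn_cauchyKernel_mul hk hz).circleIntegrable hR)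
    ((continuousOn_cauchyKernel_mul hl hz).circleIntegrable hR)

lemma cauchyTransform_const_mul (R : ℝ) (a : ℂ) (k : ℂ → ℂ) (z : ℂ) :
    cauchyTransform R (fun ζ ↦ a * k ζ) z = a * cauchyTransform R k z := by
  simp only [cauchyTransform, mul_left_comm _ a]
  exact circleAverage_fun_smul (a := a)

lemma norm_sum_rpow_le_sum {p : ℝ} (hp0 : 0 < p) (hp1 : p < 1) {ι : Type*} (s : Finset ι)
    (a : ι → ℂ) : ‖∑ i ∈ s, a i‖ ^ p ≤ ∑ i ∈ s, ‖a i‖ ^ p := by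
  refine Finset.le_sum_of_subadditive (fun w : ℂ ↦ ‖w‖ ^ p) (by simp [hp0.ne'])
    (fun x y ↦ ?_) s a
  exact (Real.rpow_le_rpow (norm_nonneg _) (norm_add_le x y) hp0.le).trans
    (Real.rpow_add_le_add_rpow (norm_nonneg _) (norm_nonneg _) hp0.le hp1.le)

lemma cauchyTransform_sum {R : ℝ} {ι : Type*} (s : Finset ι) {k : ι → ℂ → ℂ}
    (hk : ∀ i ∈ s, ContinuousOn (k i) (Metric.sphere 0 R)) {z : ℂ} (hz : z ∈ Metric.ball 0 R) :
    cauchyTransform R (fun ζ ↦ ∑ i ∈ s, k i ζ) z = ∑ i ∈ s, cauchyTransform R (k i) z := by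
  have hR : 0 ≤ R := (norm_nonneg z).trans (mem_ball_zero_iff.1 hz).le
  simp only [cauchyTransform, Finset.mul_sum]
  exact circleAverage_fun_sum fun i hi ↦
    (continuousOn_cauchyKernel_mul (hk i hi) hz).circleIntegrable hR

/-- Kolmogorov's inequality for the Cauchy transform of a continuous function on a circle. -/
lemma cos_mul_circleAverage_cauchyTransform_le {p : ℝ} (hp0 : 0 < p) (hp1 : p < 1)
    {R r : ℝ} (hr : 0 < r) (hrR : r < R) {k : ℂ → ℂ} (hk : ContinuousOn k (Metric.sphere 0 R)) :
    Real.cos (p * (π / 2)) * circleAverage (fun z ↦ ‖cauchyTransform R k z‖ ^ p) 0 r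
      ≤ 4 * (circleAverage (fun ζ ↦ ‖k ζ‖) 0 R + 1) ^ p := by
  have hR := hr.trans hrR
  let c : Fin 4 → ℂ := ![1, -1, I, -I]
  let u : Fin 4 → ℂ → ℝ := fun i ζ ↦ max ((starRingEnd ℂ (c i) * k ζ).re) 0 + 1
  have hc : ∀ i, ‖c i‖ = 1 := by intro i; fin_cases i <;> simp [c]
  have hu : ∀ i, ContinuousOn (u i) (Metric.sphere 0 R) := fun i ↦
    (ContinuousOn.sup (continuous_re.comp_continuousOn (continuousOn_const.mul hk))
      continuousOn_const).add continuousOn_const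
  have hu1 : ∀ i ζ, 1 ≤ u i ζ := fun i ζ ↦ le_add_of_nonneg_left (le_max_right _ _)
  have hule : ∀ i ζ, u i ζ ≤ ‖k ζ‖ + 1 := fun i ζ ↦ by
    have := re_le_norm (starRingEnd ℂ (c i) * k ζ)
    rw [norm_mul, RCLike.norm_conj, hc, one_mul] at this
    exact add_le_add_left (max_le this (norm_nonneg _)) 1
  have hdecomp : k = fun ζ ↦ ∑ i, c i * (u i ζ : ℂ) := by
    funext ζ
    have hmax (x : ℝ) : max x 0 - max (-x) 0 = x :=
      max_zero_sub_max_neg_zero_eq_self x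
    have h1 := hmax (k ζ).re
    have h2 := hmax (k ζ).im
    apply Complex.ext <;> simp [Fin.sum_univ_four, c, u] <;> linarith
  let K : Fin 4 → ℂ → ℂ := fun i ↦ cauchyTransform R (fun ζ ↦ u i ζ)
  have huc : ∀ i, ContinuousOn (fun ζ ↦ (u i ζ : ℂ)) (Metric.sphere 0 R) := fun i ↦
    continuous_ofReal.comp_continuousOn (hu i)
  have hsph : Metric.sphere (0 : ℂ) r ⊆ Metric.ball 0 R :=
    Metric.sphere_subset_closedBall.trans (Metric.closedBall_subset_ball hrR)
  have hint {F : ℂ → ℂ} (hF : DifferentiableOn ℂ F (Metric.ball 0 R)) :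
      CircleIntegrable (fun z ↦ ‖F z‖ ^ p) 0 r :=
    ((hF.continuousOn.mono hsph).norm.rpow_const fun _ _ ↦ Or.inr hp0.le).circleIntegrable hr.le
  have hKint : ∀ i, CircleIntegrable (fun z ↦ ‖K i z‖ ^ p) 0 r := fun i ↦
    hint (differentiableOn_cauchyTransform hR (huc i))
  have hpt : ∀ z ∈ Metric.sphere (0 : ℂ) |r|, ‖cauchyTransform R k z‖ ^ p ≤ ∑ i, ‖K i z‖ ^ p := by
    intro z hz
    rw [abs_of_pos hr] at hz
    have hsum : cauchyTransform R k z = ∑ i, c i * K i z := by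
      conv_lhs => rw [hdecomp]
      rw [cauchyTransform_sum (k := fun i ζ ↦ c i * u i ζ) _
        (fun i _ ↦ continuousOn_const.mul (huc i)) (hsph hz)]
      exact Finset.sum_congr rfl fun i _ ↦ cauchyTransform_const_mul _ _ _ _
    rw [hsum]
    refine (norm_sum_rpow_le_sum hp0 hp1 _ _).trans_eq (Finset.sum_congr rfl fun i _ ↦ ?_)
    rw [norm_mul, hc, one_mul]
  have hcos : 0 ≤ Real.cos (p * (π / 2)) :=
    Real.cos_nonneg_of_mem_Icc ⟨by nlinarith [pi_pos], by nlinarith [pi_pos]⟩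
  have hnk : CircleIntegrable (fun ζ ↦ ‖k ζ‖) 0 R := hk.norm.circleIntegrable hR.le
  have hone : CircleIntegrable (fun _ ↦ (1 : ℝ)) 0 R := continuousOn_const.circleIntegrable hR.le
  have havg : ∀ i, circleAverage (u i) 0 R ≤ circleAverage (fun ζ ↦ ‖k ζ‖) 0 R + 1 := fun i ↦ by
    calc circleAverage (u i) 0 R ≤ circleAverage (fun ζ ↦ ‖k ζ‖ + 1) 0 R :=
          circleAverage_mono ((hu i).circleIntegrable hR.le)
            ((hk.norm.add continuousOn_const).circleIntegrable hR.le) fun ζ _ ↦ hule i ζ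
      _ = _ := by rw [circleAverage_fun_add hnk hone, circleAverage_const]
  calc Real.cos (p * (π / 2)) * circleAverage (fun z ↦ ‖cauchyTransform R k z‖ ^ p) 0 r
      ≤ Real.cos (p * (π / 2)) * circleAverage (fun z ↦ ∑ i, ‖K i z‖ ^ p) 0 r := by
        refine mul_le_mul_of_nonneg_left (circleAverage_mono
          (hint (differentiableOn_cauchyTransform hR hk)) ?_ hpt) hcos
        exact CircleIntegrable.fun_sum _ fun i _ ↦ hKint i
    _ = ∑ i, Real.cos (p * (π / 2)) * circleAverage (fun z ↦ ‖K i z‖ ^ p) 0 r := by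
        rw [circleAverage_fun_sum fun i _ ↦ hKint i, Finset.mul_sum]
    _ ≤ ∑ _i : Fin 4, (circleAverage (fun ζ ↦ ‖k ζ‖) 0 R + 1) ^ p := by
        refine Finset.sum_le_sum fun i _ ↦
          (cos_mul_circleAverage_cauchyTransform_ofReal_le hp0 hp1 hr hrR (hu i) (hu1 i)).trans ?_
        exact Real.rpow_le_rpow (circleAverage_nonneg_of_nonneg
          fun ζ _ ↦ zero_le_one.trans (hu1 i ζ)) (havg i) hp0.le
    _ = _ := by simp

lemma cauchyTransform_eq_self {R : ℝ} (hR : 0 < R) {h : ℂ → ℂ}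
    (hh : DifferentiableOn ℂ h (Metric.closedBall 0 R)) {z : ℂ} (hz : z ∈ Metric.ball 0 R) :
    cauchyTransform R h z = h z := by
  rw [← abs_of_pos hR] at hz
  have hd : DiffContOnCl ℂ h (Metric.ball 0 |R|) := by
    rw [abs_of_pos hR]
    exact (hh.mono Metric.closure_ball_subset_closedBall).diffContOnCl
  simpa [cauchyTransform] using hd.circleAverage_smul_div hz

lemma cauchyTransform_conj {R : ℝ} (hR : 0 < R) {g : ℂ → ℂ}
    (hg : DifferentiableOn ℂ g (Metric.closedBall 0 R)) {z : ℂ} (hz : z ∈ Metric.ball 0 R) :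
    cauchyTransform R (fun ζ ↦ starRingEnd ℂ (g ζ)) z = starRingEnd ℂ (g 0) := by
  rw [mem_ball_zero_iff] at hz
  let q : ℂ → ℂ := fun ζ ↦ (R : ℂ) ^ 2 / ((R : ℂ) ^ 2 - starRingEnd ℂ z * ζ) * g ζ
  have hne : ∀ ζ ∈ Metric.closedBall (0 : ℂ) R, (R : ℂ) ^ 2 - starRingEnd ℂ z * ζ ≠ 0 := by
    intro ζ hζ h0
    rw [mem_closedBall_zero_iff] at hζ
    have := congrArg norm (sub_eq_zero.1 h0)
    rw [norm_pow, norm_real, Real.norm_of_nonneg hR.le, norm_mul, RCLike.norm_conj] at this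
    nlinarith [norm_nonneg z, norm_nonneg ζ]
  have hq : DifferentiableOn ℂ q (Metric.closedBall 0 R) :=
    ((differentiableOn_const _).div ((differentiableOn_const _).sub
      ((differentiableOn_const _).mul differentiableOn_id)) hne).mul hg
  have hmean : circleAverage q 0 R = g 0 := by
    rw [DiffContOnCl.circleAverage]
    · simp [q, hR.ne']
    · rw [abs_of_pos hR]
      exact (hq.mono Metric.closure_ball_subset_closedBall).diffContOnCl
  have hint : CircleIntegrable q 0 R :=
    (hq.continuousOn.mono Metric.sphere_subset_closedBall).circleIntegrable hR.le
  have hconj := conjCLE.toContinuousLinearMap.circleAverage_comp_comm hint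
  rw [hmean] at hconj
  refine Eq.trans (circleAverage_congr_sphere fun ζ hζ ↦ ?_) hconj
  rw [abs_of_pos hR, mem_sphere_zero_iff_norm] at hζ
  have hζζ : ζ * starRingEnd ℂ ζ = (R : ℂ) ^ 2 := by
    rw [mul_conj, normSq_eq_norm_sq, hζ, ofReal_pow]
  have hζ0 : starRingEnd ℂ ζ ≠ 0 := by
    rw [Ne, map_eq_zero]
    rintro rfl
    simp [hR.ne] at hζ
  have hker : ζ / (ζ - z) = (R : ℂ) ^ 2 / ((R : ℂ) ^ 2 - z * starRingEnd ℂ ζ) := by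
    rw [← hζζ, ← sub_mul, mul_div_mul_right _ _ hζ0]
  simp [q, hker]

lemma circleMean_eq_circleAverage (p : ℝ) (f : ℂ → ℂ) (r : ℝ) :
    circleMean p f r = circleAverage (fun z ↦ ‖f z‖ ^ p) 0 r ^ (1 / p) := by
  simp [circleMean, circleAverage, circleMap]

lemma InHardy.analytic_part {h g f : ℂ → ℂ} (hh : DifferentiableOn ℂ h unitDisk)
    (hg : DifferentiableOn ℂ g unitDisk) (hf : ∀ z ∈ unitDisk, f z = h z + starRingEnd ℂ (g z))
    (hf1 : InHardy 1 f) {p : ℝ} (hp0 : 0 < p) (hp1 : p < 1) : InHardy p h := by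
  obtain ⟨M, hM⟩ := hf1
  have hcos : 0 < Real.cos (p * (π / 2)) :=
    Real.cos_pos_of_mem_Ioo ⟨by nlinarith [pi_pos], by nlinarith [pi_pos]⟩
  refine ⟨(4 * (M + ‖g 0‖ + 1) ^ p / Real.cos (p * (π / 2))) ^ (1 / p), fun r hr hr1 ↦ ?_⟩
  obtain ⟨R, hrR, hR1⟩ := exists_between hr1
  have hR := hr.trans hrR
  have hball : Metric.closedBall (0 : ℂ) R ⊆ unitDisk := Metric.closedBall_subset_ball hR1
  have hsph : Metric.sphere (0 : ℂ) R ⊆ unitDisk := Metric.sphere_subset_closedBall.trans hball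
  have hhc := hh.continuousOn.mono hsph
  have hgc : ContinuousOn (fun ζ ↦ starRingEnd ℂ (g ζ)) (Metric.sphere 0 R) :=
    continuous_conj.comp_continuousOn (hg.continuousOn.mono hsph)
  have hfc : ContinuousOn f (Metric.sphere 0 R) := (hhc.add hgc).congr fun z hz ↦ hf z (hsph hz)
  let k : ℂ → ℂ := fun z ↦ h z + starRingEnd ℂ (g z - g 0)
  have hgc0 : ContinuousOn (fun ζ ↦ starRingEnd ℂ (g ζ - g 0)) (Metric.sphere 0 R) :=
    continuous_conj.comp_continuousOn ((hg.continuousOn.mono hsph).sub continuousOn_const)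
  have hkc : ContinuousOn k (Metric.sphere 0 R) := hhc.add hgc0
  have hfR : circleAverage (fun ζ ↦ ‖f ζ‖) 0 R ≤ M := by
    simpa [circleMean_eq_circleAverage] using hM R hR hR1
  have hkR : circleAverage (fun ζ ↦ ‖k ζ‖) 0 R ≤ M + ‖g 0‖ := by
    have hconst : CircleIntegrable (fun _ ↦ ‖g 0‖) 0 R :=
      continuousOn_const.circleIntegrable hR.le
    calc circleAverage (fun ζ ↦ ‖k ζ‖) 0 R ≤ circleAverage (fun ζ ↦ ‖f ζ‖ + ‖g 0‖) 0 R := by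
          refine circleAverage_mono (hkc.norm.circleIntegrable hR.le)
            ((hfc.norm.add continuousOn_const).circleIntegrable hR.le) fun ζ hζ ↦ ?_
          rw [abs_of_pos hR] at hζ
          have hkf : k ζ = f ζ - starRingEnd ℂ (g 0) := by
            rw [hf ζ (hsph hζ)]
            simp only [k, map_sub]
            ring
          rw [hkf]
          exact (norm_sub_le _ _).trans_eq (by rw [RCLike.norm_conj])
      _ = circleAverage (fun ζ ↦ ‖f ζ‖) 0 R + ‖g 0‖ := by
          rw [circleAverage_fun_add (hfc.norm.circleIntegrable hR.le) hconst,
            circleAverage_const]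
      _ ≤ M + ‖g 0‖ := by gcongr
  have hkh : ∀ z ∈ Metric.ball (0 : ℂ) R, cauchyTransform R k z = h z := fun z hz ↦ by
    rw [cauchyTransform_add hhc hgc0 hz, cauchyTransform_eq_self hR (hh.mono hball) hz,
      cauchyTransform_conj (g := fun ζ ↦ g ζ - g 0) hR
        ((hg.mono hball).sub (differentiableOn_const _)) hz]
    simp
  have hmean : circleAverage (fun z ↦ ‖h z‖ ^ p) 0 r
      = circleAverage (fun z ↦ ‖cauchyTransform R k z‖ ^ p) 0 r := by
    refine circleAverage_congr_sphere fun z hz ↦ ?_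
    rw [abs_of_pos hr, mem_sphere_zero_iff_norm] at hz
    simp only [hkh z (mem_ball_zero_iff.2 (hz.trans_lt hrR))]
  have hk0 : 0 ≤ circleAverage (fun ζ ↦ ‖k ζ‖) 0 R :=
    circleAverage_nonneg_of_nonneg fun ζ _ ↦ norm_nonneg _
  rw [circleMean_eq_circleAverage]
  refine Real.rpow_le_rpow (circleAverage_nonneg_of_nonneg fun z _ ↦ by positivity) ?_
    (by positivity)
  rw [le_div_iff₀ hcos, mul_comm, hmean]
  refine (cos_mul_circleAverage_cauchyTransform_le hp0 hp1 hr hrR hkc).trans ?_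
  gcongr

/-- If `f = h + conj g ∈ h¹`, then `h, g ∈ H^p` for every `0 < p < 1`. -/
theorem parts_in_Hp_of_h1 (h g f : ℂ → ℂ)
    (hh : DifferentiableOn ℂ h unitDisk) (hg : DifferentiableOn ℂ g unitDisk)
    (hg0 : g 0 = 0)
    (hf : ∀ z ∈ unitDisk, f z = h z + (starRingEnd ℂ) (g z))
    (hf1 : InHardy 1 f) :
    ∀ p : ℝ, 0 < p → p < 1 → InHardy p h ∧ InHardy p g := by
  intro p hp0 hp1
  refine ⟨hf1.analytic_part hh hg hf hp0 hp1, ?_⟩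
  have hf1' : InHardy 1 (fun z ↦ starRingEnd ℂ (f z)) := by
    simpa only [InHardy, circleMean, RCLike.norm_conj] using hf1
  refine hf1'.analytic_part hg hh (fun z hz ↦ ?_) hp0 hp1
  rw [hf z hz, map_add, conj_conj, add_comm]
end
end
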